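/- Let κ > 0 be real, l a positive integer, and m, μ complex numbers with Re m < 0 and 0 < Im μ < 2π. Let σ be a real number with 0 < σ < −Re(m)/κ. Then the function (y₁,…,y_l) ↦ F(σ+iy₁,…,σ+iy_l) is well defined (no poles occur) and absolutely integrable on ℝ^l, and the Selberg-type integral A_l(μ;m) := i^l ∫_{ℝ^l} F(σ+iy₁,…,σ+iy_l) dy₁⋯dy_l satisfies A_l(μ;m) = (2πi)^l · e^{(μ−πi)(l−1−2m)l/(2κ)} · (1−e^{μ})^{l(m−l+1)/κ} · ∏_{j=0}^{l−1} [Γ(1+(j+1)/κ)/Γ(1+1/κ)] · Γ((j−m)/κ). In particular the value does not depend on the choice of σ. (Since 0 < Im μ < 2π, 1−e^{μ} never lies in (−∞,0], so the principal power is well defined.) -/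

import Mathlib

open Complex MeasureTheory Real Finset

/-- The q-Selberg integrand
`F(s₁,…,s_l) = exp((μ−πi)(s₁+⋯+s_l)) ∏_u Γ(s_u) Γ(−s_u−m/κ)
  ∏_{u≠v} Γ(s_u−s_v+1/κ)/Γ(s_u−s_v)`. -/
noncomputable def qSelbergF (κ : ℝ) {l : ℕ} (m μ : ℂ) (s : Fin l → ℂ) : ℂ :=
  Complex.exp ((μ - (π : ℂ) * Complex.I) * ∑ u, s u) *
  (∏ u, Complex.Gamma (s u) * Complex.Gamma (-s u - m / (κ : ℂ))) *
  ∏ u, ∏ v ∈ Finset.univ.erase u,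
    Complex.Gamma (s u - s v + 1 / (κ : ℂ)) / Complex.Gamma (s u - s v)

/-- The Selberg-type integral `A_l(μ;m)`, as an integral over the contour
`Re s_u = σ`, `u = 1,…,l`. -/
noncomputable def ASelberg (κ : ℝ) (l : ℕ) (m μ : ℂ) (σ : ℝ) : ℂ :=
  Complex.I ^ l * ∫ y : Fin l → ℝ, qSelbergF κ m μ (fun u => (σ : ℂ) + Complex.I * (y u))

theorem integral_vertical_sub_eq_zero {f : ℂ → ℂ} {a b : ℝ} (hab : a ≤ b)
    (hd : DifferentiableOn ℂ f {z | a ≤ z.re ∧ z.re ≤ b})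
    (hf : ∀ ε > 0, ∃ T : ℝ, ∀ z : ℂ, a ≤ z.re → z.re ≤ b → T ≤ |z.im| → ‖f z‖ ≤ ε)
    (hi : Integrable fun y : ℝ => f (b + I * y) - f (a + I * y)) :
    ∫ y : ℝ, (f (b + I * y) - f (a + I * y)) = 0 := by
  have hcont : ∀ c : ℝ, a ≤ c → c ≤ b → Continuous fun y : ℝ => f (c + I * y) := by
    intro c h1 h2
    refine hd.continuousOn.comp_continuous (by fun_prop) fun y => ?_
    simp [h1, h2]
  have h1 := intervalIntegral_tendsto_integral hi Filter.tendsto_neg_atTop_atBot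
    Filter.tendsto_id
  refine tendsto_nhds_unique h1 ?_
  rw [Metric.tendsto_atTop]
  intro ε hε
  obtain ⟨T, hT⟩ := hf (ε / (4 * (b - a + 1))) (by have := sub_nonneg.2 hab; positivity)
  refine ⟨max T 1, fun R hR => ?_⟩
  have hR1 : 1 ≤ R := (le_max_right _ _).trans hR
  have hRT : T ≤ R := (le_max_left _ _).trans hR
  have h2 := Complex.integral_boundary_rect_eq_zero_of_differentiableOn f
    (a + (-R : ℝ) * I) (b + (R : ℝ) * I) (hd.mono (by
      intro z hz
      simp only [mem_reProdIm, add_re, ofReal_re, mul_re, I_re, mul_zero, ofReal_im, I_im,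
        mul_one, sub_self, add_zero, Set.uIcc_of_le hab] at hz
      exact hz.1))
  simp only [add_re, ofReal_re, mul_re, I_re, mul_zero, ofReal_im, I_im, mul_one, sub_self,
    add_zero, add_im, mul_im, zero_add] at h2
  have key : ∀ t : ℝ, |t| = R → ‖∫ x in a..b, f (x + t * I)‖ ≤ ε / (4 * (b - a + 1)) * (b - a) := by
    intro t ht
    have := intervalIntegral.norm_integral_le_of_norm_le_const (a := a) (b := b)
      (f := fun x : ℝ => f (x + t * I)) (C := ε / (4 * (b - a + 1))) (by
        intro x hx
        rw [Set.uIoc_of_le hab] at hx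
        refine hT _ (by simpa using hx.1.le) (by simpa using hx.2) ?_
        simpa [ht] using hRT)
    rwa [abs_of_nonneg (sub_nonneg.2 hab)] at this
  have e1 := key (-R) (by rw [abs_neg, abs_of_pos (by linarith)])
  have e2 := key R (by rw [abs_of_pos (by linarith)])
  rw [id, intervalIntegral.integral_sub ((hcont b hab le_rfl).intervalIntegrable _ _)
    ((hcont a le_rfl hab).intervalIntegrable _ _), dist_zero_right]
  have h3 : (∫ y in -R..R, f (b + I * y)) - ∫ y in -R..R, f (a + I * y)
      = I * ((∫ x in a..b, f (x + (-R : ℝ) * I)) - ∫ x in a..b, f (x + (R : ℝ) * I)) := by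
    simp only [mul_comm I, smul_eq_mul] at h2 ⊢
    linear_combination (-I) * h2 + ((∫ y in -R..R, f (b + y * I)) - ∫ y in -R..R, f (a + y * I)) * Complex.I_mul_I
  rw [h3, norm_mul, norm_I, one_mul]
  refine (norm_sub_le _ _).trans_lt ?_
  have : ε / (4 * (b - a + 1)) * (b - a) ≤ ε / 4 := by
    have := sub_nonneg.2 hab
    rw [div_mul_eq_mul_div, div_le_div_iff₀ (by positivity) (by positivity)]
    nlinarith
  linarith

theorem integrable_exp_neg_mul_abs {c : ℝ} (hc : 0 < c) :
    Integrable fun y : ℝ => Real.exp (-c * |y|) := by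
  rw [← integrableOn_univ, ← Set.Iic_union_Ioi (a := (0 : ℝ))]
  refine IntegrableOn.union ?_ ?_
  · refine (integrableOn_exp_mul_Iic hc 0).congr_fun (fun y hy => ?_) measurableSet_Iic
    simp [abs_of_nonpos (Set.mem_Iic.1 hy)]
  · refine (integrableOn_exp_mul_Ioi (neg_lt_zero.2 hc) 0).congr_fun (fun y hy => ?_)
      measurableSet_Ioi
    simp [abs_of_pos (Set.mem_Ioi.1 hy)]

/-- A function holomorphic on a closed strip and exponentially decaying there has the same
integral over both boundary lines. -/
theorem integral_vertical_eq {f : ℂ → ℂ} {a b : ℝ} (hab : a ≤ b)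
    (hd : DifferentiableOn ℂ f {z | a ≤ z.re ∧ z.re ≤ b}) {C c : ℝ} (hc : 0 < c)
    (hf : ∀ z : ℂ, a ≤ z.re → z.re ≤ b → ‖f z‖ ≤ C * Real.exp (-c * |z.im|)) :
    ∫ y : ℝ, f (b + I * y) = ∫ y : ℝ, f (a + I * y) := by
  have hcont : ∀ x : ℝ, a ≤ x → x ≤ b → Integrable fun y : ℝ => f (x + I * y) := by
    intro x h1 h2
    have : Continuous fun y : ℝ => f (x + I * y) := by
      refine hd.continuousOn.comp_continuous (by fun_prop) fun y => ?_
      simp [h1, h2]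
    refine ((integrable_exp_neg_mul_abs hc).const_mul C).mono' this.aestronglyMeasurable
      (.of_forall fun y => ?_)
    simpa using hf (x + I * y) (by simpa using h1) (by simpa using h2)
  rw [← sub_eq_zero, ← integral_sub (hcont b hab le_rfl) (hcont a le_rfl hab)]
  refine integral_vertical_sub_eq_zero hab hd ?_ ((hcont b hab le_rfl).sub (hcont a le_rfl hab))
  intro ε hε
  have hlim : Filter.Tendsto (fun t : ℝ => C * Real.exp (-c * t)) Filter.atTop (nhds 0) := by
    have : Filter.Tendsto (fun t : ℝ => Real.exp (-c * t)) Filter.atTop (nhds 0) :=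
      Real.tendsto_exp_atBot.comp (Filter.tendsto_id.const_mul_atTop_of_neg (neg_lt_zero.2 hc))
    simpa using this.const_mul C
  obtain ⟨T, hT⟩ := Filter.eventually_atTop.1 (hlim.eventually (gt_mem_nhds hε))
  exact ⟨T, fun z h1 h2 h3 => (hf z h1 h2).trans (hT _ h3).le⟩

theorem Gamma_eq_integral_exp {z : ℂ} (hz : 0 < z.re) :
    Complex.Gamma z = ∫ u : ℝ, Complex.exp (z * u - Complex.exp u) := by
  rw [Complex.Gamma_eq_integral hz, Complex.GammaIntegral, ← Real.range_exp, ← Set.image_univ,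
    integral_image_eq_integral_abs_deriv_smul MeasurableSet.univ
      (fun x _ => (Real.hasDerivAt_exp x).hasDerivWithinAt) Real.exp_injective.injOn,
    Measure.restrict_univ]
  refine integral_congr_ae (.of_forall fun u => ?_)
  have h : (Real.exp u : ℂ) ≠ 0 := by exact_mod_cast (Real.exp_pos u).ne'
  simp only [abs_of_pos (Real.exp_pos u), real_smul]
  rw [Complex.cpow_sub _ _ h, Complex.cpow_one, Complex.cpow_def_of_ne_zero h,
    ← Complex.ofReal_log (Real.exp_pos u).le, Real.log_exp]
  push_cast
  rw [sub_eq_add_neg, Complex.exp_add, mul_comm z]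
  field_simp

theorem exp_mul_sub_exp_le {σ k : ℝ} (hσ : 0 < σ) (hk : 0 < k) (y : ℝ) :
    Real.exp (σ * y - k * Real.exp y) ≤ Real.exp (2 * σ ^ 2 / k) * Real.exp (-σ * |y|) := by
  rw [← Real.exp_add, Real.exp_le_exp]
  have h0 : 0 ≤ 2 * σ ^ 2 / k := by positivity
  rcases le_total y 0 with hy | hy
  · rw [abs_of_nonpos hy]
    nlinarith [Real.exp_pos y, mul_pos hk (Real.exp_pos y)]
  · rw [abs_of_nonneg hy]
    have h1 : y ^ 2 / 2 ≤ Real.exp y := by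
      have := Real.quadratic_le_exp_of_nonneg hy
      linarith
    have h2 : k * (y ^ 2 / 2) ≤ k * Real.exp y := mul_le_mul_of_nonneg_left h1 hk.le
    have h3 : 0 ≤ k / 2 * (y - 2 * σ / k) ^ 2 := by positivity
    have h4 : k / 2 * (y - 2 * σ / k) ^ 2 = k * (y ^ 2 / 2) - 2 * σ * y + 2 * σ ^ 2 / k := by
      field_simp
      ring
    linarith

theorem norm_Gamma_le_of_im_nonneg {α β θ : ℝ} (hα : 0 < α) (hθ0 : 0 ≤ θ) (hθ : θ < π / 2)
    {z : ℂ} (h1 : α ≤ z.re) (h2 : z.re ≤ β) (h3 : 0 ≤ z.im) :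
    ‖Complex.Gamma z‖ ≤ (Real.exp (2 * β ^ 2 / Real.cos θ) * ∫ y : ℝ, Real.exp (-α * |y|)) *
      Real.exp (-θ * z.im) := by
  have hz : 0 < z.re := hα.trans_le h1
  have hk : 0 < Real.cos θ := Real.cos_pos_of_mem_Ioo ⟨by linarith, hθ⟩
  set f : ℂ → ℂ := fun w => Complex.exp (z * (-I * w) - Complex.exp (-I * w)) with hf
  have hnorm : ∀ w : ℂ, -θ ≤ w.re → w.re ≤ 0 → ‖f w‖ ≤
      Real.exp (z.im * w.re) * (Real.exp (2 * z.re ^ 2 / Real.cos θ) *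
        Real.exp (-z.re * |w.im|)) := by
    intro w hw1 hw2
    have hcos : Real.cos θ ≤ Real.cos w.re := by
      rw [← Real.cos_abs w.re, abs_of_nonpos hw2]
      exact Real.cos_le_cos_of_nonneg_of_le_pi (by linarith) (by linarith [Real.pi_pos])
        (by linarith)
    have hE : (z * (-I * w) - Complex.exp (-I * w)).re
        = z.im * w.re + (z.re * w.im - Real.exp w.im * Real.cos w.re) := by
      simp [Complex.exp_re, Complex.mul_re, Complex.mul_im]
      ring
    rw [hf, Complex.norm_exp, hE, Real.exp_add]
    refine mul_le_mul_of_nonneg_left ?_ (Real.exp_pos _).le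
    refine le_trans ?_ (exp_mul_sub_exp_le hz hk w.im)
    rw [Real.exp_le_exp]
    nlinarith [Real.exp_pos w.im]
  have hfd : Differentiable ℂ f := by
    rw [hf]; fun_prop
  have hshift := integral_vertical_eq (f := f) (a := -θ) (b := 0) (by linarith)
    hfd.differentiableOn (C := Real.exp (2 * z.re ^ 2 / Real.cos θ)) hz (by
      intro w hw1 hw2
      refine (hnorm w hw1 hw2).trans (mul_le_of_le_one_left (by positivity) ?_)
      exact Real.exp_le_one_iff.2 (mul_nonpos_of_nonneg_of_nonpos h3 hw2))
  have hG : Complex.Gamma z = ∫ y : ℝ, f ((-θ : ℝ) + I * y) := by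
    rw [← hshift, Gamma_eq_integral_exp hz]
    refine integral_congr_ae (.of_forall fun u => ?_)
    have h : -I * (((0 : ℝ) : ℂ) + I * u) = u := by
      rw [ofReal_zero, zero_add, ← mul_assoc, neg_mul, I_mul_I, neg_neg, one_mul]
    simp only [hf, h]
  rw [hG]
  have hInt := (integrable_exp_neg_mul_abs hα).const_mul
    (Real.exp (-θ * z.im) * Real.exp (2 * β ^ 2 / Real.cos θ))
  refine (norm_integral_le_of_norm_le hInt (.of_forall fun y => ?_)).trans ?_
  · refine (hnorm _ (by simp) (by simpa using hθ0)).trans ?_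
    simp only [add_re, ofReal_re, mul_re, I_re, zero_mul, I_im, ofReal_im, mul_zero, sub_self,
      add_zero, add_im, mul_im, one_mul, zero_add]
    rw [mul_comm z.im, mul_assoc]
    gcongr
  · rw [integral_const_mul]
    exact le_of_eq (by ring)

/-- Exponential decay of the Gamma function on vertical strips. -/
theorem exists_norm_Gamma_le {α : ℝ} (β : ℝ) {ε : ℝ} (hα : 0 < α) (hε : 0 < ε) :
    ∃ C > 0, ∀ z : ℂ, α ≤ z.re → z.re ≤ β →
      ‖Complex.Gamma z‖ ≤ C * Real.exp (-(π / 2 - ε) * |z.im|) := by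
  set θ := max 0 (π / 2 - ε) with hθ
  have hθ1 : θ < π / 2 := max_lt (by positivity) (by linarith)
  have hpos : 0 < ∫ y : ℝ, Real.exp (-α * |y|) :=
    integral_exp_pos (integrable_exp_neg_mul_abs hα)
  refine ⟨Real.exp (2 * β ^ 2 / Real.cos θ) * ∫ y : ℝ, Real.exp (-α * |y|),
    mul_pos (Real.exp_pos _) hpos, fun z h1 h2 => ?_⟩
  have key : ‖Complex.Gamma z‖ ≤ (Real.exp (2 * β ^ 2 / Real.cos θ) *
      ∫ y : ℝ, Real.exp (-α * |y|)) * Real.exp (-θ * |z.im|) := by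
    rcases le_total 0 z.im with h3 | h3
    · rw [abs_of_nonneg h3]
      exact norm_Gamma_le_of_im_nonneg hα (le_max_left _ _) hθ1 h1 h2 h3
    · have := norm_Gamma_le_of_im_nonneg (z := (starRingEnd ℂ) z) (β := β) hα (le_max_left _ _)
        hθ1 (by simpa using h1) (by simpa using h2) (by simpa using h3)
      rw [Complex.Gamma_conj, Complex.norm_conj, conj_im] at this
      rwa [abs_of_nonpos h3]
  refine key.trans (mul_le_mul_of_nonneg_left ?_ (mul_pos (Real.exp_pos _) hpos).le)
  rw [Real.exp_le_exp]
  have := le_max_right 0 (π / 2 - ε)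
  have := mul_le_mul_of_nonneg_right this (abs_nonneg z.im)
  simp only [neg_mul]
  linarith

/-- The reciprocal Gamma function grows at most like `exp ((π / 2 + ε) * |im z|)` on vertical
strips. -/
theorem exists_norm_inv_Gamma_le (α β : ℝ) {ε : ℝ} (hε : 0 < ε) :
    ∃ C > 0, ∀ z : ℂ, α ≤ z.re → z.re ≤ β →
      ‖(Complex.Gamma z)⁻¹‖ ≤ C * Real.exp ((π / 2 + ε) * |z.im|) := by
  obtain ⟨N, hN⟩ := exists_nat_ge β
  obtain ⟨C, hC, hΓ⟩ := exists_norm_Gamma_le (1 - α + N) one_pos hε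
  obtain ⟨M, hM⟩ := (isCompact_Icc.reProdIm isCompact_Icc :
    IsCompact (Set.Icc α β ×ℂ Set.Icc (-1) 1)).exists_bound_of_continuousOn
      Complex.differentiable_one_div_Gamma.continuous.continuousOn
  refine ⟨max M C, lt_max_of_lt_right hC, fun z h1 h2 => ?_⟩
  rcases le_total |z.im| 1 with h3 | h3
  · have h4 := hM z (by
      rw [mem_reProdIm]
      exact ⟨⟨h1, h2⟩, abs_le.1 h3⟩)
    have h5 : 1 ≤ Real.exp ((π / 2 + ε) * |z.im|) := Real.one_le_exp (by positivity)
    calc _ ≤ M := h4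
      _ ≤ max M C := le_max_left _ _
      _ ≤ _ := le_mul_of_one_le_right (hC.le.trans (le_max_right _ _)) h5
  · have hshift : ∀ n : ℕ, ‖Complex.Gamma (1 - z)‖ ≤ ‖Complex.Gamma (1 - z + n)‖ := by
      intro n
      induction n with
      | zero => simp
      | succ n ih =>
        have hne : 1 - z + n ≠ 0 := by
          intro h
          have := congrArg Complex.im h
          simp at this
          simp [this] at h3
          linarith
        rw [Nat.cast_succ, ← add_assoc, Complex.Gamma_add_one _ hne, norm_mul]
        refine ih.trans (le_mul_of_one_le_left (norm_nonneg _) (h3.trans ?_))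
        have := Complex.abs_im_le_norm (1 - z + n)
        simpa using this
    have hsin : ‖Complex.sin (π * z)‖ ≤ Real.exp (π * |z.im|) := by
      rw [Complex.sin, norm_div, norm_mul, norm_I, mul_one, Complex.norm_two, div_le_iff₀ two_pos]
      refine (norm_sub_le _ _).trans ?_
      rw [Complex.norm_exp, Complex.norm_exp]
      have e1 : Real.exp (-(π * z) * I).re ≤ Real.exp (π * |z.im|) := by
        rw [Real.exp_le_exp]
        simp only [mul_re, neg_re, neg_im, mul_im, ofReal_re, ofReal_im, I_re, I_im]
        nlinarith [le_abs_self z.im, Real.pi_pos]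
      have e2 : Real.exp (π * z * I).re ≤ Real.exp (π * |z.im|) := by
        rw [Real.exp_le_exp]
        simp only [mul_re, mul_im, ofReal_re, ofReal_im, I_re, I_im]
        nlinarith [neg_abs_le z.im, Real.pi_pos]
      linarith
    have him : z.im ≠ 0 := by
      intro h; simp [h] at h3; linarith
    have hrefl : (Complex.Gamma z)⁻¹ = Complex.Gamma (1 - z) * Complex.sin (π * z) / π := by
      have hz : Complex.Gamma z ≠ 0 := by
        refine Complex.Gamma_ne_zero fun m hm => him ?_
        rw [hm]; simp
      have hs : Complex.sin (π * z) ≠ 0 := by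
        intro h
        obtain ⟨k, hk⟩ := Complex.sin_eq_zero_iff.1 h
        have := congrArg Complex.im hk
        simp [Real.pi_ne_zero] at this
        exact him this
      have hp : (π : ℂ) ≠ 0 := by exact_mod_cast Real.pi_ne_zero
      have := Complex.Gamma_mul_Gamma_one_sub z
      rw [eq_div_iff hs] at this
      rw [eq_div_iff hp, inv_mul_eq_iff_eq_mul₀ hz]
      linear_combination -this
    have hN' : ‖Complex.Gamma (1 - z)‖ ≤ C * Real.exp (-(π / 2 - ε) * |z.im|) := by
      refine (hshift N).trans ((hΓ _ ?_ ?_).trans_eq ?_)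
      · simp; linarith
      · simp; linarith
      · simp
    rw [hrefl, norm_div, norm_mul, Complex.norm_real, Real.norm_of_nonneg Real.pi_pos.le]
    have h6 : ‖Complex.Gamma (1 - z)‖ * ‖Complex.sin (π * z)‖ ≤
        C * Real.exp ((π / 2 + ε) * |z.im|) := by
      refine (mul_le_mul hN' hsin (norm_nonneg _) (by positivity)).trans_eq ?_
      rw [mul_assoc, ← Real.exp_add]
      congr 2
      ring
    calc _ ≤ ‖Complex.Gamma (1 - z)‖ * ‖Complex.sin (π * z)‖ :=
          div_le_self (by positivity) (by linarith [Real.pi_gt_three])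
      _ ≤ _ := h6
      _ ≤ _ := mul_le_mul_of_nonneg_right (le_max_right _ _) (Real.exp_pos _).le

/-- The ratio `Γ(z + g) / Γ(z)`. -/
noncomputable def gammaRatio (g : ℝ) (z : ℂ) : ℂ := Complex.Gamma (z + g) / Complex.Gamma z

/-- The interaction factor `∏_{u ≠ v} Γ(s_u - s_v + g) / Γ(s_u - s_v)`. -/
noncomputable def gammaKernel (g : ℝ) {l : ℕ} (s : Fin l → ℂ) : ℂ :=
  ∏ u, ∏ v ∈ univ.erase u, gammaRatio g (s u - s v)

/-- The integral over `ℝ^l` of a product of one-body weights against the interaction factor. -/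
noncomputable def kernelIntegral (g : ℝ) (l : ℕ) (φ : ℝ → ℂ) : ℂ :=
  ∫ y : Fin l → ℝ, (∏ u, φ (y u)) * gammaKernel g (fun u => I * y u)

theorem gammaRatio_zero (g : ℝ) : gammaRatio g 0 = 0 := by
  simp [gammaRatio, Complex.Gamma_zero]

theorem gammaRatio_add_one {g : ℝ} {z : ℂ} (hz : z ≠ 0) (hzg : z + g ≠ 0) :
    gammaRatio g (z + 1) = gammaRatio g z * ((z + g) / z) := by
  rw [gammaRatio, gammaRatio, add_right_comm, Complex.Gamma_add_one _ hz,
    Complex.Gamma_add_one _ hzg, mul_comm, mul_comm z, mul_div_mul_comm]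

theorem gammaRatio_mul_gammaRatio_one_sub {g : ℝ} (hg : 0 < g) {x : ℂ} (hx : x.re = 0) :
    gammaRatio g x * gammaRatio g (1 - x) =
      gammaRatio g x * gammaRatio g (-x) * ((x - g) / x) := by
  rcases eq_or_ne x 0 with rfl | h
  · simp [gammaRatio_zero]
  · rw [sub_eq_neg_add, gammaRatio_add_one (neg_ne_zero.2 h) (fun h => by
      have := congrArg Complex.re h
      simp [hx] at this
      exact hg.ne' this), ← mul_assoc, ← neg_div_neg_eq]
    congr 2 <;> ring

theorem gammaRatio_add_one_mul_gammaRatio_neg {g : ℝ} (hg : 0 < g) {x : ℂ} (hx : x.re = 0) :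
    gammaRatio g (x + 1) * gammaRatio g (-x) =
      gammaRatio g x * gammaRatio g (-x) * ((x + g) / x) := by
  rcases eq_or_ne x 0 with rfl | h
  · simp [gammaRatio_zero]
  · rw [gammaRatio_add_one h (fun h => by
      have := congrArg Complex.re h
      simp [hx] at this
      exact hg.ne' this)]
    ring

theorem differentiableAt_Gamma_of_re_pos {z : ℂ} (hz : 0 < z.re) :
    DifferentiableAt ℂ Complex.Gamma z :=
  Complex.differentiableAt_Gamma z fun m hm => by
    rw [hm] at hz
    simp at hz
    exact absurd hz (by simp)

theorem differentiableAt_gammaRatio {g : ℝ} {z : ℂ} (hz : -g < z.re) :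
    DifferentiableAt ℂ (gammaRatio g) z := by
  have h1 : DifferentiableAt ℂ (fun z : ℂ => Complex.Gamma (z + g)) z :=
    DifferentiableAt.comp z (differentiableAt_Gamma_of_re_pos (by simp; linarith)) (by fun_prop)
  have h2 := h1.mul (Complex.differentiable_one_div_Gamma z)
  exact h2.congr_of_eventuallyEq (.of_forall fun w => by simp [gammaRatio, div_eq_mul_inv])

theorem exists_norm_gammaRatio_le {g : ℝ} {α : ℝ} (β : ℝ) (hα : -g < α) {ε : ℝ} (hε : 0 < ε) :
    ∃ C ≥ 1, ∀ z : ℂ, α ≤ z.re → z.re ≤ β → ‖gammaRatio g z‖ ≤ C * Real.exp (ε * |z.im|) := by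
  obtain ⟨C₁, h1, H1⟩ := exists_norm_Gamma_le (α := α + g) (β + g) (by linarith) (half_pos hε)
  obtain ⟨C₂, h2, H2⟩ := exists_norm_inv_Gamma_le α β (half_pos hε)
  refine ⟨max 1 (C₁ * C₂), le_max_left _ _, fun z hz1 hz2 => ?_⟩
  have e1 := H1 (z + g) (by simpa using hz1) (by simpa using hz2)
  have e2 := H2 z hz1 hz2
  rw [add_im, ofReal_im, add_zero] at e1
  rw [gammaRatio, div_eq_mul_inv, norm_mul]
  calc _ ≤ _ := mul_le_mul e1 e2 (norm_nonneg _) (by positivity)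
    _ = C₁ * C₂ * Real.exp (ε * |z.im|) := by
      rw [mul_mul_mul_comm, ← Real.exp_add]
      congr 2
      ring
    _ ≤ _ := by
      gcongr
      exact le_max_right _ _

theorem continuous_gammaKernel {g : ℝ} (hg : 0 < g) (l : ℕ) :
    Continuous fun y : Fin l → ℝ => gammaKernel g (fun u => I * y u) := by
  refine continuous_finsetProd _ fun u _ => continuous_finsetProd _ fun v _ => ?_
  rw [continuous_iff_continuousAt]
  intro y
  refine ContinuousAt.comp (f := fun y : Fin l → ℝ => I * (y u : ℂ) - I * y v)
    (differentiableAt_gammaRatio (by simpa using hg)).continuousAt (by fun_prop)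

theorem exists_norm_gammaKernel_le {g : ℝ} (hg : 0 < g) (l : ℕ) {ε : ℝ} (hε : 0 < ε) :
    ∃ C > 0, ∀ y : Fin l → ℝ,
      ‖gammaKernel g (fun u => I * y u)‖ ≤ C * Real.exp (ε * ∑ u, |y u|) := by
  obtain ⟨C, hC, h⟩ := exists_norm_gammaRatio_le (g := g) (α := 0) 0 (by linarith)
    (ε := ε / (2 * l + 1)) (by positivity)
  refine ⟨∏ _u : Fin l, ∏ _v : Fin l, C, by positivity, fun y => ?_⟩
  set e := ε / (2 * l + 1) with he
  have he0 : 0 < e := by positivity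
  have hb : ∀ u v, ‖gammaRatio g (I * y u - I * y v)‖ ≤ C * Real.exp (e * (|y u| + |y v|)) := by
    intro u v
    refine (h _ (by simp) (by simp)).trans ?_
    gcongr
    simpa using abs_sub (y u) (y v)
  have hone : ∀ u v, 1 ≤ C * Real.exp (e * (|y u| + |y v|)) := fun u v =>
    one_le_mul_of_one_le_of_one_le hC (Real.one_le_exp (by positivity))
  calc ‖gammaKernel g (fun u => I * y u)‖
      ≤ ∏ u, ∏ v, C * Real.exp (e * (|y u| + |y v|)) := by
        rw [gammaKernel, norm_prod]
        refine prod_le_prod (fun _ _ => norm_nonneg _) fun u _ => ?_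
        rw [norm_prod]
        refine (prod_le_prod (fun _ _ => norm_nonneg _) fun v _ => hb u v).trans ?_
        exact prod_le_prod_of_subset_of_one_le (erase_subset _ _)
          (fun v _ => by positivity) (fun v _ _ => hone u v)
    _ = (∏ _u : Fin l, ∏ _v : Fin l, C) * Real.exp (e * (2 * l) * ∑ u, |y u|) := by
        simp_rw [prod_mul_distrib, ← Real.exp_sum, ← mul_sum, sum_add_distrib]
        congr 2
        simp [← mul_sum]
        ring
    _ ≤ _ := by
        have : e * (2 * l) ≤ ε := by
          rw [he, div_mul_eq_mul_div, div_le_iff₀ (by positivity)]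
          nlinarith
        gcongr

theorem integrable_exp_neg_mul_sum_abs (l : ℕ) {δ : ℝ} (hδ : 0 < δ) :
    Integrable fun y : Fin l → ℝ => Real.exp (-δ * ∑ u, |y u|) := by
  simp_rw [mul_sum, Real.exp_sum]
  exact Integrable.fintype_prod fun _ => integrable_exp_neg_mul_abs hδ

theorem norm_prod_le_exp {l : ℕ} {φ : ℝ → ℂ} {M δ : ℝ}
    (h : ∀ y, ‖φ y‖ ≤ M * Real.exp (-δ * |y|)) (y : Fin l → ℝ) :
    ‖∏ u, φ (y u)‖ ≤ M ^ l * Real.exp (-δ * ∑ u, |y u|) := by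
  rw [norm_prod, mul_sum, Real.exp_sum]
  refine (prod_le_prod (fun _ _ => norm_nonneg _) fun u _ => h (y u)).trans_eq ?_
  rw [prod_mul_distrib]
  simp

theorem exists_norm_prod_mul_gammaKernel_le {g : ℝ} (hg : 0 < g) (l : ℕ) {δ : ℝ} (hδ : 0 < δ) :
    ∃ C > 0, ∀ (M : ℝ) (φ : ℝ → ℂ), 0 ≤ M → (∀ y, ‖φ y‖ ≤ M * Real.exp (-δ * |y|)) →
      ∀ y : Fin l → ℝ, ‖(∏ u, φ (y u)) * gammaKernel g (fun u => I * y u)‖ ≤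
        C * M ^ l * Real.exp (-(δ / 2) * ∑ u, |y u|) := by
  obtain ⟨C, hC, h⟩ := exists_norm_gammaKernel_le hg l (half_pos hδ)
  refine ⟨C, hC, fun M φ hM hφ y => ?_⟩
  rw [norm_mul]
  refine (mul_le_mul (norm_prod_le_exp hφ y) (h y) (norm_nonneg _) (by positivity)).trans_eq ?_
  rw [mul_mul_mul_comm, ← Real.exp_add, mul_comm C]
  congr 2
  ring

theorem integrable_prod_mul_gammaKernel {g : ℝ} (hg : 0 < g) (l : ℕ) {δ M : ℝ} (hδ : 0 < δ)
    {φ : ℝ → ℂ} (hc : Continuous φ) (h : ∀ y, ‖φ y‖ ≤ M * Real.exp (-δ * |y|)) :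
    Integrable fun y : Fin l → ℝ => (∏ u, φ (y u)) * gammaKernel g (fun u => I * y u) := by
  obtain ⟨C, hC, H⟩ := exists_norm_prod_mul_gammaKernel_le hg l hδ
  have hM : 0 ≤ M := by simpa using (norm_nonneg _).trans (h 0)
  refine ((integrable_exp_neg_mul_sum_abs l (half_pos hδ)).const_mul (C * M ^ l)).mono'
    ?_ (.of_forall (H M φ hM h))
  refine Continuous.aestronglyMeasurable ?_
  exact (continuous_finsetProd _ fun u _ => hc.comp (continuous_apply u)).mul
    (continuous_gammaKernel hg l)

theorem exists_norm_kernelIntegral_le {g : ℝ} (hg : 0 < g) (l : ℕ) {δ : ℝ} (hδ : 0 < δ) :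
    ∃ C > 0, ∀ (M : ℝ) (φ : ℝ → ℂ), 0 ≤ M → (∀ y, ‖φ y‖ ≤ M * Real.exp (-δ * |y|)) →
      ‖kernelIntegral g l φ‖ ≤ C * M ^ l := by
  obtain ⟨C, hC, H⟩ := exists_norm_prod_mul_gammaKernel_le hg l hδ
  have hi := integrable_exp_neg_mul_sum_abs l (half_pos hδ)
  refine ⟨C * ∫ y : Fin l → ℝ, Real.exp (-(δ / 2) * ∑ u, |y u|),
    mul_pos hC (integral_exp_pos hi), fun M φ hM hφ => ?_⟩
  refine (norm_integral_le_of_norm_le (hi.const_mul (C * M ^ l))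
    (.of_forall (H M φ hM hφ))).trans_eq ?_
  rw [integral_const_mul]
  ring

/-- Holomorphic dependence of `kernelIntegral` on a parameter of the weight. -/
theorem differentiableAt_kernelIntegral {g : ℝ} (hg : 0 < g) (l : ℕ) {φ : ℂ → ℝ → ℂ} {p₀ : ℂ}
    {r δ M : ℝ} (hr : 0 < r) (hδ : 0 < δ)
    (hd : ∀ y, DifferentiableOn ℂ (fun p => φ p y) (Metric.ball p₀ r))
    (hc : ∀ p ∈ Metric.ball p₀ r, Continuous (φ p))
    (hb : ∀ p ∈ Metric.ball p₀ r, ∀ y, ‖φ p y‖ ≤ M * Real.exp (-δ * |y|)) :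
    DifferentiableAt ℂ (fun p => kernelIntegral g l (φ p)) p₀ := by
  obtain ⟨C, hC, H⟩ := exists_norm_prod_mul_gammaKernel_le hg l hδ
  have hM : 0 ≤ M := by
    simpa using (norm_nonneg _).trans (hb p₀ (Metric.mem_ball_self hr) 0)
  set F : ℂ → (Fin l → ℝ) → ℂ :=
    fun p y => (∏ u, φ p (y u)) * gammaKernel g (fun u => I * y u) with hF
  have hFd : ∀ y, DifferentiableOn ℂ (fun p => F p y) (Metric.ball p₀ r) := fun y =>
    (DifferentiableOn.fun_finsetProd fun u _ => hd (y u)).mul_const _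
  have hFi : ∀ p ∈ Metric.ball p₀ r, Integrable (F p) := fun p hp =>
    integrable_prod_mul_gammaKernel hg l hδ (hc p hp) (hb p hp)
  have hr2 : 0 < r / 2 := half_pos hr
  have hsub : ∀ p ∈ Metric.ball p₀ (r / 2), Metric.closedBall p (r / 4) ⊆ Metric.ball p₀ r := by
    intro p hp q hq
    have h1 := Metric.mem_ball.1 hp
    have h2 := Metric.mem_closedBall.1 hq
    exact Metric.mem_ball.2 ((dist_triangle _ _ _).trans_lt (by linarith))
  have hderiv : ∀ y, ∀ p ∈ Metric.ball p₀ (r / 2), ‖deriv (fun p => F p y) p‖ ≤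
      C * M ^ l * Real.exp (-(δ / 2) * ∑ u, |y u|) / (r / 4) := by
    intro y p hp
    refine Complex.norm_deriv_le_of_forall_mem_sphere_norm_le (by positivity) ?_ ?_
    · exact ((hFd y).mono (hsub p hp)).diffContOnCl_ball subset_rfl
    · intro q hq
      exact H M (φ q) hM (hb q (hsub p hp (Metric.sphere_subset_closedBall hq))) y
  have hmain := hasDerivAt_integral_of_dominated_loc_of_deriv_le (μ := volume)
    (F := F) (F' := fun p y => deriv (fun p => F p y) p) (x₀ := p₀)
    (s := Metric.ball p₀ (r / 2))
    (bound := fun y => C * M ^ l * Real.exp (-(δ / 2) * ∑ u, |y u|) / (r / 4))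
    (Metric.ball_mem_nhds _ hr2) ?_ (hFi p₀ (Metric.mem_ball_self hr)) ?_
    (.of_forall hderiv)
    (((integrable_exp_neg_mul_sum_abs l (half_pos hδ)).const_mul _).div_const _)
    (.of_forall fun y p hp => ?_)
  · exact hmain.2.differentiableAt
  · filter_upwards [Metric.ball_mem_nhds p₀ hr] with p hp using (hFi p hp).aestronglyMeasurable
  · have hseq : Filter.Tendsto (fun n : ℕ => p₀ + ((r / (n + 2) : ℝ) : ℂ)) Filter.atTop
        (nhdsWithin p₀ {p₀}ᶜ) := by
      refine tendsto_nhdsWithin_iff.2 ⟨?_, .of_forall fun n => ?_⟩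
      · have h1 : Filter.Tendsto (fun n : ℕ => r / ((n : ℝ) + 2)) Filter.atTop (nhds 0) :=
          tendsto_const_nhds.div_atTop
            (Filter.tendsto_atTop_add_const_right _ _ tendsto_natCast_atTop_atTop)
        have h2 := ((Complex.continuous_ofReal.tendsto 0).comp h1).const_add p₀
        simpa using h2
      · have : r / ((n : ℝ) + 2) ≠ 0 := by positivity
        rw [Set.mem_compl_singleton_iff, ne_eq, add_eq_left, Complex.ofReal_eq_zero]
        exact this
    refine aestronglyMeasurable_of_tendsto_ae (u := Filter.atTop) (μ := volume)
      (f := fun (n : ℕ) y => slope (fun p => F p y) p₀ (p₀ + ((r / (n + 2) : ℝ) : ℂ)))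
      (fun n => ?_) (.of_forall fun y => ?_)
    · simp only [slope, vsub_eq_sub]
      refine AEStronglyMeasurable.fun_const_smul (((hFi _ ?_).aestronglyMeasurable).sub
        (hFi p₀ (Metric.mem_ball_self hr)).aestronglyMeasurable) _
      rw [Metric.mem_ball, dist_eq_norm, add_sub_cancel_left, Complex.norm_real,
        Real.norm_of_nonneg (by positivity)]
      exact div_lt_self hr (by have : (0 : ℝ) ≤ n := n.cast_nonneg; linarith)
    · have h := ((hFd y).differentiableAt (Metric.ball_mem_nhds p₀ hr)).hasDerivAt
      exact h.tendsto_slope.comp hseq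
  · refine DifferentiableAt.hasDerivAt ((hFd y).differentiableAt ?_)
    exact Metric.isOpen_ball.mem_nhds (Metric.ball_subset_ball (by linarith) hp)

section Identities

variable {l : ℕ} {s : Fin l → ℂ} {g : ℂ}

theorem degree_prod_sub_prod_lt (s r : Fin l → ℂ) :
    ((∏ j, (Polynomial.X - Polynomial.C (r j))) -
      ∏ j, (Polynomial.X - Polynomial.C (s j))).degree <
        ((univ : Finset (Fin l)).card : WithBot ℕ) := by
  have h1 : ∀ r : Fin l → ℂ, (∏ j, (Polynomial.X - Polynomial.C (r j))).degree = (l : WithBot ℕ) := fun r => by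
    simp [Polynomial.degree_prod]
  refine (Polynomial.degree_sub_lt_left ((h1 r).trans (h1 s).symm) ?_ ?_).trans_eq ?_
  · exact (Polynomial.monic_prod_of_monic _ _ fun j _ => Polynomial.monic_X_sub_C _).ne_zero
  · rw [(Polynomial.monic_prod_of_monic _ _ fun j _ => Polynomial.monic_X_sub_C _),
      (Polynomial.monic_prod_of_monic _ _ fun j _ => Polynomial.monic_X_sub_C _)]
  · rw [h1, card_univ, Fintype.card_fin]

theorem eval_prod_sub_prod (s : Fin l → ℂ) (g : ℂ) (i : Fin l) :
    ((∏ j, (Polynomial.X - Polynomial.C (s j - g))) -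
      ∏ j, (Polynomial.X - Polynomial.C (s j))).eval (s i) =
      g * ∏ j ∈ univ.erase i, (s i - s j + g) := by
  have h0 : ∏ j, (Polynomial.X - Polynomial.C (s j)).eval (s i) = 0 :=
    prod_eq_zero (mem_univ i) (by simp)
  rw [Polynomial.eval_sub, Polynomial.eval_prod, Polynomial.eval_prod, h0,
    ← mul_prod_erase _ _ (mem_univ i)]
  simp [sub_add]

theorem sum_prod_sub_add_div (hs : Function.Injective s) (hg : g ≠ 0) :
    ∑ i, ∏ j ∈ univ.erase i, (s i - s j + g) / (s i - s j) = l := by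
  rcases Nat.eq_zero_or_pos l with rfl | hl
  · simp
  have h := Lagrange.coeff_eq_sum (s := univ) (v := s) hs.injOn
    (degree_prod_sub_prod_lt s fun j => s j - g)
  have hn : ∀ r : Fin l → ℂ, (∏ j, (Polynomial.X - Polynomial.C (r j))).coeff (l - 1) =
      - ∑ j, r j := fun r => by
    rw [← Polynomial.prod_X_sub_C_nextCoeff r, Polynomial.nextCoeff]
    simp [hl.ne']
  rw [card_univ, Fintype.card_fin, Polynomial.coeff_sub, hn, hn] at h
  simp_rw [eval_prod_sub_prod, mul_div_assoc, ← prod_div_distrib, ← mul_sum] at h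
  rw [← mul_right_inj' hg, ← h]
  simp
  ring

theorem sum_prod_sub_mul_div (hs : Function.Injective s) (hg : g ≠ 0) (t : ℂ) :
    ∑ i, ∏ j ∈ univ.erase i, (t - s j) * ((s i - s j + g) / (s i - s j)) =
      ((∏ j, (t + g - s j)) - ∏ j, (t - s j)) / g := by
  rcases Nat.eq_zero_or_pos l with rfl | hl
  · simp
  have h := congrArg (Polynomial.eval t) (Lagrange.eq_interpolate (s := univ) (v := s) hs.injOn
    (degree_prod_sub_prod_lt s fun j => s j - g))
  simp_rw [eval_prod_sub_prod, Lagrange.interpolate_apply, Lagrange.basis,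
    Lagrange.basisDivisor, Polynomial.eval_finsetSum, Polynomial.eval_mul, Polynomial.eval_prod,
    Polynomial.eval_sub, Polynomial.eval_prod, Polynomial.eval_mul, Polynomial.eval_C,
    mul_assoc, ← mul_sum] at h
  simp only [Polynomial.eval_sub, Polynomial.eval_X, Polynomial.eval_C] at h
  rw [eq_div_iff hg, mul_comm]
  simp_rw [← sub_add, sub_add_eq_add_sub] at h
  rw [h]
  congr 1
  refine sum_congr rfl fun i _ => ?_
  rw [← prod_mul_distrib]
  refine prod_congr rfl fun j _ => ?_
  rw [sub_add_eq_add_sub]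
  ring

theorem sum_mul_prod_sub_mul_div (hs : Function.Injective s) (hg : g ≠ 0) (t : ℂ) :
    ∑ i, s i * ∏ j ∈ univ.erase i, (t - s j) * ((s i - s j + g) / (s i - s j)) =
      t * (((∏ j, (t + g - s j)) - ∏ j, (t - s j)) / g) - l * ∏ j, (t - s j) := by
  rw [← sum_prod_sub_mul_div hs hg, ← sum_prod_sub_add_div hs hg, sum_mul, mul_sum,
    ← sum_sub_distrib]
  refine sum_congr rfl fun i _ => ?_
  rw [← mul_prod_erase univ (fun j => t - s j) (mem_univ i), prod_mul_distrib]
  ring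

theorem sum_sub_mul_prod_sub_mul_div (hs : Function.Injective s) (hg : g ≠ 0) (a t : ℂ) :
    ∑ i, (a - s i) * ∏ j ∈ univ.erase i, (t - s j) * ((s i - s j - g) / (s i - s j)) =
      ((t - a) * (((∏ j, (t - g - s j)) - ∏ j, (t - s j)) / g)) + l * ∏ j, (t - s j) := by
  have h1 := sum_prod_sub_mul_div hs (neg_ne_zero.2 hg) t
  have h2 := sum_mul_prod_sub_mul_div hs (neg_ne_zero.2 hg) t
  simp_rw [← sub_eq_add_neg] at h1 h2
  simp_rw [sub_mul a, sum_sub_distrib, ← mul_sum]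
  rw [h1, h2]
  field_simp
  ring

end Identities

theorem prod_erase_eq_prod_succAbove {M : Type*} [CommMonoid M] {n : ℕ} (i : Fin (n + 1))
    (f : Fin (n + 1) → M) : ∏ j ∈ univ.erase i, f j = ∏ j, f (i.succAbove j) := by
  rw [← Finset.compl_singleton, ← Fin.image_succAbove_univ,
    prod_image (Fin.succAbove_right_injective.injOn)]

/-- Splitting off the `i`-th variable from the interaction factor. -/
theorem gammaKernel_succAbove (g : ℝ) {n : ℕ} (i : Fin (n + 1)) (s : Fin (n + 1) → ℂ) :
    gammaKernel g s = gammaKernel g (fun j => s (i.succAbove j)) *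
      ∏ j, gammaRatio g (s i - s (i.succAbove j)) * gammaRatio g (s (i.succAbove j) - s i) := by
  have h : ∀ {m : ℕ} (s : Fin m → ℂ) (u), ∏ v ∈ univ.erase u, gammaRatio g (s u - s v) =
      ∏ v, if v = u then 1 else gammaRatio g (s u - s v) := fun s u => by
    rw [← mul_prod_erase univ _ (mem_univ u), if_pos rfl, one_mul]
    exact prod_congr rfl fun v hv => by rw [if_neg (ne_of_mem_erase hv)]
  rw [gammaKernel, Fin.prod_univ_succAbove _ i, prod_erase_eq_prod_succAbove, prod_mul_distrib,
    gammaKernel]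
  simp_rw [h s, h fun j => s (i.succAbove j)]
  have h2 : ∀ u : Fin n, (∏ v, if v = i.succAbove u then (1 : ℂ) else
      gammaRatio g (s (i.succAbove u) - s v)) = gammaRatio g (s (i.succAbove u) - s i) *
      ∏ v, if v = u then 1 else gammaRatio g (s (i.succAbove u) - s (i.succAbove v)) := fun u => by
    rw [Fin.prod_univ_succAbove _ i, if_neg (Fin.succAbove_ne i u).symm]
    simp
  simp_rw [h2, prod_mul_distrib]
  ring

theorem gammaKernel_eq_zero (g : ℝ) {l : ℕ} {s : Fin l → ℂ} (hs : ¬ Function.Injective s) :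
    gammaKernel g s = 0 := by
  simp only [Function.Injective, not_forall] at hs
  obtain ⟨u, v, huv, hne⟩ := hs
  refine prod_eq_zero (mem_univ u) (prod_eq_zero (i := v) ?_ ?_)
  · exact mem_erase.2 ⟨Ne.symm hne, mem_univ v⟩
  · rw [huv, sub_self, gammaRatio_zero]

/-- The one-body weight `e^{cz} Γ(z) Γ(a - z)`. -/
noncomputable def gammaWeight (a c z : ℂ) : ℂ :=
  Complex.exp (c * z) * Complex.Gamma z * Complex.Gamma (a - z)

theorem differentiableAt_gammaWeight {a c z : ℂ} (h0 : 0 < z.re) (h1 : z.re < a.re) :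
    DifferentiableAt ℂ (gammaWeight a c) z := by
  refine (DifferentiableAt.mul (by fun_prop) (differentiableAt_Gamma_of_re_pos h0)).mul ?_
  exact DifferentiableAt.comp (g := Complex.Gamma) (f := fun z => a - z) z
    (differentiableAt_Gamma_of_re_pos (by simpa using h1)) (by fun_prop)

theorem exists_norm_gammaWeight_le' {α : ℝ} (β : ℝ) {ε : ℝ} (hα : 0 < α) (hε : 0 < ε) :
    ∃ C > 0, ∀ a c z : ℂ, α ≤ z.re → z.re ≤ β → α ≤ a.re - z.re → a.re - z.re ≤ β →
      ‖gammaWeight a c z‖ ≤ C * Real.exp (c.re * z.re - c.im * z.im -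
        (π / 2 - ε) * (|z.im| + |a.im - z.im|)) := by
  obtain ⟨C, hC, h⟩ := exists_norm_Gamma_le β hα hε
  refine ⟨C * C, by positivity, fun a c z h1 h2 h3 h4 => ?_⟩
  rw [gammaWeight, norm_mul, norm_mul, Complex.norm_exp, mul_re]
  have e1 := h z h1 h2
  have e2 := h (a - z) (by simpa using h3) (by simpa using h4)
  rw [sub_im] at e2
  refine (mul_le_mul (mul_le_mul_of_nonneg_left e1 (Real.exp_pos _).le) e2 (norm_nonneg _)
    (by positivity)).trans_eq ?_
  have : Real.exp (c.re * z.re - c.im * z.im - (π / 2 - ε) * (|z.im| + |a.im - z.im|)) =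
      Real.exp (c.re * z.re - c.im * z.im) * Real.exp (-(π / 2 - ε) * |z.im|) *
        Real.exp (-(π / 2 - ε) * |a.im - z.im|) := by
    rw [← Real.exp_add, ← Real.exp_add]
    congr 1
    ring
  rw [this]
  ring

/-- Exponential decay of the weight, locally uniformly in the parameters. -/
theorem exists_norm_gammaWeight_le {α : ℝ} (β : ℝ) {η R : ℝ} (hα : 0 < α) (hη : 0 < η)
    (hR : 0 ≤ R) :
    ∃ M > 0, ∀ a c z : ℂ, α ≤ z.re → z.re ≤ β → α ≤ a.re - z.re → a.re - z.re ≤ β →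
      |c.re| ≤ R → |c.im| ≤ π - η → |a.im| ≤ R →
      ‖gammaWeight a c z‖ ≤ M * Real.exp (-(η / 2) * |z.im|) := by
  obtain ⟨C, hC, h⟩ := exists_norm_gammaWeight_le' β hα (ε := η / 4) (by positivity)
  refine ⟨C * Real.exp (R * β + π / 2 * R), by positivity, fun a c z h1 h2 h3 h4 h5 h6 h7 => ?_⟩
  refine (h a c z h1 h2 h3 h4).trans ?_
  rw [mul_assoc, ← Real.exp_add]
  gcongr
  have e1 : c.re * z.re ≤ R * β :=
    mul_le_mul ((le_abs_self _).trans h5) h2 (hα.le.trans h1) hR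
  have e2 : -(c.im * z.im) ≤ (π - η) * |z.im| :=
    (neg_le_abs _).trans (by rw [abs_mul]; gcongr)
  have e3 : 2 * |z.im| - R ≤ |z.im| + |a.im - z.im| := by
    have := abs_sub_abs_le_abs_sub z.im a.im
    rw [abs_sub_comm] at this
    linarith
  have h8 : 0 ≤ π / 2 - η / 4 := by linarith [abs_nonneg c.im, Real.pi_pos]
  have e4 := mul_le_mul_of_nonneg_left e3 h8
  nlinarith [mul_nonneg hη.le hR]

/-- The interaction of an inserted variable with the remaining ones. -/
noncomputable def insertionFactor (g : ℝ) {n : ℕ} (z : ℂ) (w : Fin n → ℝ) : ℂ :=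
  ∏ j, gammaRatio g (z - I * w j) * gammaRatio g (1 - (z - I * w j))

theorem differentiableAt_insertionFactor {g : ℝ} (hg : 0 < g) {n : ℕ} (w : Fin n → ℝ) {z : ℂ}
    (h0 : 0 ≤ z.re) (h1 : z.re ≤ 1) :
    DifferentiableAt ℂ (fun z => insertionFactor g z w) z := by
  refine DifferentiableAt.fun_finsetProd fun j _ => DifferentiableAt.mul ?_ ?_
  · exact DifferentiableAt.comp (g := gammaRatio g) (f := fun z => z - I * w j) z
      (differentiableAt_gammaRatio (by simp; linarith)) (by fun_prop)
  · exact DifferentiableAt.comp (g := gammaRatio g) (f := fun z => 1 - (z - I * w j)) z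
      (differentiableAt_gammaRatio (by simp; linarith)) (by fun_prop)

theorem exists_norm_insertionFactor_le {g : ℝ} (hg : 0 < g) (n : ℕ) {ε : ℝ} (hε : 0 < ε) :
    ∃ C > 0, ∀ (z : ℂ) (w : Fin n → ℝ), 0 ≤ z.re → z.re ≤ 1 →
      ‖insertionFactor g z w‖ ≤ C * (Real.exp (ε * |z.im|) * Real.exp (ε * ∑ j, |w j|)) := by
  obtain ⟨C, hC, h⟩ := exists_norm_gammaRatio_le (g := g) (α := 0) 1 (by linarith)
    (ε := ε / (2 * (n + 1))) (by positivity)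
  set e := ε / (2 * (n + 1)) with he
  have he0 : 0 < e := by positivity
  refine ⟨(C * C) ^ n, by positivity, fun z w h0 h1 => ?_⟩
  have hj : ∀ j, ‖gammaRatio g (z - I * w j) * gammaRatio g (1 - (z - I * w j))‖ ≤
      (C * C) * Real.exp (2 * e * (|z.im| + |w j|)) := by
    intro j
    have e1 := h (z - I * w j) (by simpa using h0) (by simpa using h1)
    have e2 := h (1 - (z - I * w j)) (by simpa using h1) (by simpa using h0)
    have him : |(z - I * w j).im| ≤ |z.im| + |w j| := by simpa using abs_sub z.im (w j)
    have him2 : |(1 - (z - I * w j)).im| ≤ |z.im| + |w j| := by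
      rw [sub_im, one_im, zero_sub, abs_neg]
      exact him
    rw [norm_mul]
    refine (mul_le_mul (e1.trans (c := C * Real.exp (e * (|z.im| + |w j|))) (by gcongr))
      (e2.trans (c := C * Real.exp (e * (|z.im| + |w j|))) (by gcongr))
      (norm_nonneg _) (by positivity)).trans_eq ?_
    rw [mul_mul_mul_comm, ← Real.exp_add]
    congr 2
    ring
  rw [insertionFactor, norm_prod]
  refine (prod_le_prod (fun _ _ => norm_nonneg _) fun j _ => hj j).trans ?_
  rw [prod_mul_distrib, ← Real.exp_sum, ← Real.exp_add]
  have h2 : ∑ j, 2 * e * (|z.im| + |w j|) = 2 * e * n * |z.im| + 2 * e * ∑ j, |w j| := by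
    rw [← mul_sum, sum_add_distrib]
    simp
    ring
  have hn : (0 : ℝ) ≤ n := n.cast_nonneg
  have h3 : 2 * e * n ≤ ε := by
    rw [he]
    field_simp
    linarith
  have h4 : 2 * e ≤ ε := by
    rw [he]
    field_simp
    linarith
  rw [h2]
  simp only [prod_const, card_univ, Fintype.card_fin]
  have h5 : 0 ≤ ∑ j, |w j| := sum_nonneg fun _ _ => abs_nonneg _
  gcongr

theorem continuous_insertionFactor {g : ℝ} (hg : 0 < g) (n : ℕ) {x : ℝ} (h0 : 0 ≤ x)
    (h1 : x ≤ 1) :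
    Continuous fun p : ℝ × (Fin n → ℝ) => insertionFactor g (x + I * p.1) p.2 := by
  refine continuous_finsetProd _ fun j _ => ?_
  rw [continuous_iff_continuousAt]
  intro p
  refine ContinuousAt.mul ?_ ?_
  · exact ContinuousAt.comp (f := fun p : ℝ × (Fin n → ℝ) => (x : ℂ) + I * p.1 - I * p.2 j)
      (differentiableAt_gammaRatio (by simp; linarith)).continuousAt (by fun_prop)
  · exact ContinuousAt.comp (f := fun p : ℝ × (Fin n → ℝ) => 1 - ((x : ℂ) + I * p.1 - I * p.2 j))
      (differentiableAt_gammaRatio (by simp; linarith)).continuousAt (by fun_prop)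

/-- Fubini for splitting off the `i`-th variable. -/
theorem integral_insertionFactor_fubini {g : ℝ} (hg : 0 < g) {n : ℕ} (i : Fin (n + 1)) {x : ℝ}
    (h0 : 0 ≤ x) (h1 : x ≤ 1) {Φ ψ : ℝ → ℂ} (hΦ : Continuous Φ) (hψ : Continuous ψ)
    {M N δ : ℝ} (hδ : 0 < δ) (hΦb : ∀ y, ‖Φ y‖ ≤ M * Real.exp (-δ * |y|))
    (hψb : ∀ y, ‖ψ y‖ ≤ N * Real.exp (-δ * |y|)) :
    (Integrable fun y : Fin (n + 1) → ℝ =>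
      Φ (y i) * insertionFactor g (x + I * y i) (fun j => y (i.succAbove j)) *
        ((∏ j, ψ (y (i.succAbove j))) * gammaKernel g fun j => I * y (i.succAbove j))) ∧
    (Integrable fun w : Fin n → ℝ => (∫ y : ℝ, Φ y * insertionFactor g (x + I * y) w) *
      ((∏ j, ψ (w j)) * gammaKernel g fun j => I * w j)) ∧
    ∫ y : Fin (n + 1) → ℝ,
      Φ (y i) * insertionFactor g (x + I * y i) (fun j => y (i.succAbove j)) *
        ((∏ j, ψ (y (i.succAbove j))) * gammaKernel g fun j => I * y (i.succAbove j)) =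
    ∫ w : Fin n → ℝ, (∫ y : ℝ, Φ y * insertionFactor g (x + I * y) w) *
      ((∏ j, ψ (w j)) * gammaKernel g fun j => I * w j) := by
  set F : ℝ × (Fin n → ℝ) → ℂ := fun p => Φ p.1 * insertionFactor g (x + I * p.1) p.2 *
        ((∏ j, ψ (p.2 j)) * gammaKernel g fun j => I * p.2 j) with hF
  have hmp := volume_preserving_piFinSuccAbove (fun _ : Fin (n + 1) => ℝ) i
  have hM : 0 ≤ M := by simpa using (norm_nonneg _).trans (hΦb 0)
  have hN : 0 ≤ N := by simpa using (norm_nonneg _).trans (hψb 0)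
  have hFi : Integrable F (volume.prod volume) := by
    obtain ⟨C, hC, hK⟩ := exists_norm_prod_mul_gammaKernel_le hg n hδ
    obtain ⟨C', hC', hE⟩ := exists_norm_insertionFactor_le hg n (ε := δ / 4) (by positivity)
    have hb := ((integrable_exp_neg_mul_abs (c := δ / 2) (by positivity)).mul_prod
      (integrable_exp_neg_mul_sum_abs n (δ := δ / 4) (by positivity))).const_mul
        (M * C' * (C * N ^ n))
    refine hb.mono' ?_ (.of_forall fun p => ?_)
    · refine Continuous.aestronglyMeasurable ?_
      refine ((hΦ.comp continuous_fst).mul (continuous_insertionFactor hg n h0 h1)).mul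
        (Continuous.mul ?_ ((continuous_gammaKernel hg n).comp continuous_snd))
      exact continuous_finsetProd _ fun j _ => hψ.comp ((continuous_apply j).comp continuous_snd)
    · have e1 := hΦb p.1
      have e2 := hE (x + I * p.1) p.2 (by simpa using h0) (by simpa using h1)
      have e3 := hK N ψ hN hψb p.2
      rw [show ((x : ℂ) + I * p.1).im = p.1 by simp] at e2
      rw [hF]
      simp only [norm_mul] at e3 ⊢
      refine (mul_le_mul (mul_le_mul e1 e2 (norm_nonneg _) (by positivity)) e3
        (by positivity) (by positivity)).trans ?_
      have e4 : M * Real.exp (-δ * |p.1|) * (C' * (Real.exp (δ / 4 * |p.1|) *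
          Real.exp (δ / 4 * ∑ j, |p.2 j|))) * (C * N ^ n * Real.exp (-(δ / 2) * ∑ j, |p.2 j|)) =
          M * C' * (C * N ^ n) * (Real.exp (-δ * |p.1| + δ / 4 * |p.1|) *
            Real.exp (δ / 4 * ∑ j, |p.2 j| + -(δ / 2) * ∑ j, |p.2 j|)) := by
        rw [Real.exp_add, Real.exp_add]
        ring
      rw [e4]
      gcongr
      · nlinarith [abs_nonneg p.1]
      · linarith
  refine ⟨(hmp.integrable_comp_emb (MeasurableEquiv.measurableEmbedding _)).2 hFi, ?_, ?_⟩
  · refine hFi.integral_prod_right.congr (.of_forall fun w => ?_)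
    simp only [hF]
    rw [integral_mul_const]
  · have h2 := hmp.integral_comp' F
    refine h2.trans ?_
    rw [Measure.volume_eq_prod, integral_prod_symm _ hFi]
    refine integral_congr_ae (.of_forall fun w => ?_)
    simp only [hF]
    rw [integral_mul_const]

/-- Moving the contour of the `i`-th variable across a strip of width one. -/
theorem integral_insertionFactor_shift {g : ℝ} (hg : 0 < g) {n : ℕ} (i : Fin (n + 1))
    {φ : ℂ → ℂ} {ψ : ℝ → ℂ} (hφ : DifferentiableOn ℂ φ {z | 0 ≤ z.re ∧ z.re ≤ 1})
    (hψ : Continuous ψ) {M N δ : ℝ} (hδ : 0 < δ)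
    (hφb : ∀ z : ℂ, 0 ≤ z.re → z.re ≤ 1 → ‖φ z‖ ≤ M * Real.exp (-δ * |z.im|))
    (hψb : ∀ y, ‖ψ y‖ ≤ N * Real.exp (-δ * |y|)) :
    ∫ y : Fin (n + 1) → ℝ,
      φ ((1 : ℝ) + I * y i) * insertionFactor g ((1 : ℝ) + I * y i)
        (fun j => y (i.succAbove j)) *
        ((∏ j, ψ (y (i.succAbove j))) * gammaKernel g fun j => I * y (i.succAbove j)) =
    ∫ y : Fin (n + 1) → ℝ,
      φ ((0 : ℝ) + I * y i) * insertionFactor g ((0 : ℝ) + I * y i)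
        (fun j => y (i.succAbove j)) *
        ((∏ j, ψ (y (i.succAbove j))) * gammaKernel g fun j => I * y (i.succAbove j)) := by
  have hcont : ∀ x : ℝ, 0 ≤ x → x ≤ 1 → Continuous fun y : ℝ => φ (x + I * y) := by
    intro x h0 h1
    refine hφ.continuousOn.comp_continuous (by fun_prop) fun y => ?_
    simp [h0, h1]
  rw [(integral_insertionFactor_fubini hg i zero_le_one le_rfl (hcont 1 zero_le_one le_rfl) hψ hδ
      (fun y => by simpa using hφb ((1 : ℝ) + I * y) (by simp) (by simp)) hψb).2.2,
    (integral_insertionFactor_fubini hg i le_rfl zero_le_one (hcont 0 le_rfl zero_le_one) hψ hδ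
      (fun y => by simpa using hφb ((0 : ℝ) + I * y) (by simp) (by simp)) hψb).2.2]
  refine integral_congr_ae (.of_forall fun w => ?_)
  obtain ⟨C, hC, hE⟩ := exists_norm_insertionFactor_le hg n (half_pos hδ)
  have hM : 0 ≤ M := by simpa using (norm_nonneg _).trans (hφb 0 (by simp) (by simp))
  have := integral_vertical_eq (f := fun z => φ z * insertionFactor g z w) (a := 0) (b := 1)
    zero_le_one (hφ.mul fun z hz =>
      (differentiableAt_insertionFactor hg w hz.1 hz.2).differentiableWithinAt)
    (C := M * C * Real.exp (δ / 2 * ∑ j, |w j|)) (c := δ / 2) (half_pos hδ) (by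
      intro z hz0 hz1
      rw [norm_mul]
      refine (mul_le_mul (hφb z hz0 hz1) (hE z w hz0 hz1) (norm_nonneg _)
        (by positivity)).trans_eq ?_
      have : Real.exp (-(δ / 2) * |z.im|) = Real.exp (-δ * |z.im|) * Real.exp (δ / 2 * |z.im|) := by
        rw [← Real.exp_add]
        congr 1
        ring
      rw [this]
      ring)
  simp only [this]

theorem exists_norm_gammaWeight_strip_le {a c : ℂ} {α β : ℝ} (hα : 0 < α) (hβ : β < a.re)
    (hc : |c.im| < π) :
    ∃ M ≥ 0, ∃ δ > 0, ∀ z : ℂ, α ≤ z.re → z.re ≤ β →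
      ‖gammaWeight a c z‖ ≤ M * Real.exp (-δ * |z.im|) := by
  obtain ⟨M, hM, h⟩ := exists_norm_gammaWeight_le (α := min α (a.re - β)) (max β (a.re - α))
    (η := π - |c.im|) (R := max |c.re| |a.im|) (lt_min hα (by linarith)) (by linarith)
    ((abs_nonneg _).trans (le_max_left _ _))
  refine ⟨M, hM.le, (π - |c.im|) / 2, by linarith, fun z h1 h2 => h a c z ?_ ?_ ?_ ?_ ?_ ?_ ?_⟩
  · exact (min_le_left _ _).trans h1
  · exact h2.trans (le_max_left _ _)
  · exact (min_le_right _ _).trans (by linarith)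
  · exact le_trans (by linarith) (le_max_right _ _)
  · exact le_max_left _ _
  · linarith
  · exact le_max_right _ _

theorem exists_norm_gammaWeight_line_le {a c : ℂ} {σ : ℝ} (h0 : 0 < σ) (h1 : σ < a.re)
    (hc : |c.im| < π) :
    ∃ M ≥ 0, ∃ δ > 0, ∀ y : ℝ, ‖gammaWeight a c (σ + I * y)‖ ≤ M * Real.exp (-δ * |y|) := by
  obtain ⟨M, hM, δ, hδ, h⟩ := exists_norm_gammaWeight_strip_le h0 h1 hc
  exact ⟨M, hM, δ, hδ, fun y => by simpa using h (σ + I * y) (by simp) (by simp)⟩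

theorem continuous_gammaWeight_line {a : ℂ} (c : ℂ) {σ : ℝ} (h0 : 0 < σ) (h1 : σ < a.re) :
    Continuous fun y : ℝ => gammaWeight a c (σ + I * y) := by
  rw [continuous_iff_continuousAt]
  intro y
  exact ContinuousAt.comp (f := fun y : ℝ => (σ : ℂ) + I * y)
    (differentiableAt_gammaWeight (by simpa using h0) (by simpa using h1)).continuousAt
    (by fun_prop)

theorem norm_linear_mul_le {φ : ℝ → ℂ} {M δ : ℝ} (hδ : 0 < δ)
    (h : ∀ y, ‖φ y‖ ≤ M * Real.exp (-δ * |y|)) (t : ℂ) (y : ℝ) :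
    ‖(t - I * y) * φ y‖ ≤ (‖t‖ + 2 / δ) * M * Real.exp (-(δ / 2) * |y|) := by
  have hM : 0 ≤ M := by simpa using (norm_nonneg _).trans (h 0)
  have h1 : ‖t - I * y‖ ≤ (‖t‖ + 2 / δ) * Real.exp (δ / 2 * |y|) := by
    refine (norm_sub_le _ _).trans ?_
    rw [add_mul]
    refine add_le_add (le_mul_of_one_le_right (norm_nonneg _)
      (Real.one_le_exp (by positivity))) ?_
    have := Real.add_one_le_exp (δ / 2 * |y|)
    rw [norm_mul, norm_I, one_mul, Complex.norm_real, Real.norm_eq_abs, div_mul_eq_mul_div,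
      le_div_iff₀ hδ]
    linarith
  rw [norm_mul]
  refine (mul_le_mul h1 (h y) (norm_nonneg _) (by positivity)).trans_eq ?_
  have : Real.exp (-(δ / 2) * |y|) = Real.exp (δ / 2 * |y|) * Real.exp (-δ * |y|) := by
    rw [← Real.exp_add]
    congr 1
    ring
  rw [this]
  ring

/-- The multivariable integral with one-body weight `e^{cz} Γ(z) Γ(a - z)`. -/
noncomputable def gammaIntegral (g : ℝ) (l : ℕ) (a c : ℂ) (σ : ℝ) : ℂ :=
  kernelIntegral g l fun y => gammaWeight a c (σ + I * y)

/-- The integral of `∏ (t - s_j)` against the weight. -/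
noncomputable def gammaMoment (g : ℝ) (l : ℕ) (a c : ℂ) (σ : ℝ) (t : ℂ) : ℂ :=
  kernelIntegral g l fun y => (t - (σ + I * y)) * gammaWeight a c (σ + I * y)

theorem integrable_gammaMoment {g : ℝ} (hg : 0 < g) (l : ℕ) {a c : ℂ} {σ : ℝ} (h0 : 0 < σ)
    (h1 : σ < a.re) (hc : |c.im| < π) (t : ℂ) :
    Integrable fun y : Fin l → ℝ =>
      (∏ u, (t - (σ + I * y u)) * gammaWeight a c (σ + I * y u)) *
        gammaKernel g (fun u => I * y u) := by
  obtain ⟨M, hM, δ, hδ, h⟩ := exists_norm_gammaWeight_line_le h0 h1 hc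
  have hb := norm_linear_mul_le hδ h (t - σ)
  simp only [sub_sub] at hb
  have hcont : Continuous fun y : ℝ => (t - (σ + I * y)) * gammaWeight a c (σ + I * y) :=
    (by fun_prop : Continuous fun y : ℝ => t - (σ + I * y)).mul
      (continuous_gammaWeight_line c h0 h1)
  generalize hφ : (fun y : ℝ => (t - (σ + I * y)) * gammaWeight a c (σ + I * y)) = φ at hcont
  have e : ∀ y : ℝ, (t - (σ + I * y)) * gammaWeight a c (σ + I * y) = φ y := fun y => by
    rw [← hφ]
  simp_rw [e] at hb ⊢
  exact integrable_prod_mul_gammaKernel hg l (half_pos hδ) hcont hb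

theorem integrable_gammaIntegral {g : ℝ} (hg : 0 < g) (l : ℕ) {a c : ℂ} {σ : ℝ} (h0 : 0 < σ)
    (h1 : σ < a.re) (hc : |c.im| < π) :
    Integrable fun y : Fin l → ℝ =>
      (∏ u, gammaWeight a c (σ + I * y u)) * gammaKernel g (fun u => I * y u) := by
  obtain ⟨M, hM, δ, hδ, h⟩ := exists_norm_gammaWeight_line_le h0 h1 hc
  have hcont := continuous_gammaWeight_line c h0 h1
  generalize hφ : (fun y : ℝ => gammaWeight a c (σ + I * y)) = φ at hcont
  have e : ∀ y : ℝ, gammaWeight a c (σ + I * y) = φ y := fun y => by rw [← hφ]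
  simp_rw [e] at h ⊢
  exact integrable_prod_mul_gammaKernel hg l hδ hcont h

theorem gammaWeight_add_one_left {a c z : ℂ} (h : a ≠ z) :
    gammaWeight (a + 1) c z = (a - z) * gammaWeight a c z := by
  rw [gammaWeight, gammaWeight, add_sub_right_comm, Complex.Gamma_add_one _ (sub_ne_zero.2 h)]
  ring

theorem gammaWeight_add_one_right {a c z : ℂ} (h : z ≠ 0) :
    gammaWeight (a + 1) c (z + 1) = Complex.exp c * (z * gammaWeight a c z) := by
  rw [gammaWeight, gammaWeight, add_sub_add_right_eq_sub, Complex.Gamma_add_one _ h, mul_add_one,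
    Complex.exp_add]
  ring

theorem insertionFactor_zero_mul {g : ℝ} (hg : 0 < g) {n : ℕ} (i : Fin (n + 1))
    (y : Fin (n + 1) → ℝ) :
    insertionFactor g ((0 : ℝ) + I * y i) (fun j => y (i.succAbove j)) *
      gammaKernel g (fun j => I * y (i.succAbove j)) =
    (∏ j, (I * y i - I * y (i.succAbove j) - g) / (I * y i - I * y (i.succAbove j))) *
      gammaKernel g (fun j => I * y j) := by
  rw [gammaKernel_succAbove g i fun j => I * (y j : ℂ), insertionFactor, mul_left_comm,
    ← prod_mul_distrib, mul_comm]
  congr 1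
  refine prod_congr rfl fun j _ => ?_
  have := gammaRatio_mul_gammaRatio_one_sub hg (x := I * y i - I * y (i.succAbove j)) (by simp)
  rw [ofReal_zero, zero_add, this, neg_sub]
  ring

theorem insertionFactor_one_mul {g : ℝ} (hg : 0 < g) {n : ℕ} (i : Fin (n + 1))
    (y : Fin (n + 1) → ℝ) :
    insertionFactor g ((1 : ℝ) + I * y i) (fun j => y (i.succAbove j)) *
      gammaKernel g (fun j => I * y (i.succAbove j)) =
    (∏ j, (I * y i - I * y (i.succAbove j) + g) / (I * y i - I * y (i.succAbove j))) *
      gammaKernel g (fun j => I * y j) := by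
  rw [gammaKernel_succAbove g i fun j => I * (y j : ℂ), insertionFactor, mul_left_comm,
    ← prod_mul_distrib, mul_comm]
  congr 1
  refine prod_congr rfl fun j _ => ?_
  have := gammaRatio_add_one_mul_gammaRatio_neg hg (x := I * y i - I * y (i.succAbove j))
    (by simp)
  rw [neg_sub] at this
  rw [ofReal_one, show (1 : ℂ) + I * y i - I * y (i.succAbove j) =
    I * y i - I * y (i.succAbove j) + 1 by ring, show (1 : ℂ) - (I * y i - I * y (i.succAbove j) + 1)
    = I * y (i.succAbove j) - I * y i by ring, this]
  ring

/-- The contour shift relation between the moments. -/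
theorem gammaMoment_relation {g : ℝ} (hg : 0 < g) (l : ℕ) {a c : ℂ} {σ : ℝ} (h0 : 0 < σ)
    (h1 : σ < a.re) (hc : |c.im| < π) (t : ℂ) :
    Complex.exp c * (t * ((gammaMoment g l a c σ (t + g) - gammaMoment g l a c σ t) / g) -
        l * gammaMoment g l a c σ t) =
      (t - a) * ((gammaMoment g l a c σ (t - g) - gammaMoment g l a c σ t) / g) +
        l * gammaMoment g l a c σ t := by
  rcases l with _ | n
  · simp [gammaMoment, kernelIntegral]
  have hg0 : (g : ℂ) ≠ 0 := by exact_mod_cast hg.ne'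
  obtain ⟨M, hM, δ, hδ, hb⟩ := exists_norm_gammaWeight_strip_le (a := a + 1) (c := c) h0
    (β := σ + 1) (by simpa using h1) hc
  obtain ⟨N, hN, δ', hδ', hb'⟩ := exists_norm_gammaWeight_line_le (c := c) h0 h1 hc
  set d := min δ (δ' / 2) with hd
  have hd0 : 0 < d := lt_min hδ (half_pos hδ')
  set W : ℝ → ℂ := fun y => gammaWeight a c (σ + I * y) with hW
  set ψ : ℝ → ℂ := fun y => (t - (σ + I * y)) * W y with hψ
  set φ : ℂ → ℂ := fun z => gammaWeight (a + 1) c (σ + z) with hφ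
  have hψc : Continuous ψ := (by fun_prop : Continuous fun y : ℝ => t - (σ + I * y)).mul
    (continuous_gammaWeight_line c h0 h1)
  have hψb : ∀ y, ‖ψ y‖ ≤ (‖t - σ‖ + 2 / δ') * N * Real.exp (-d * |y|) := fun y => by
    have := norm_linear_mul_le hδ' hb' (t - σ) y
    rw [sub_sub] at this
    refine this.trans ?_
    have := min_le_right δ (δ' / 2)
    gcongr
  have hφd : DifferentiableOn ℂ φ {z | 0 ≤ z.re ∧ z.re ≤ 1} := fun z hz =>
    (DifferentiableAt.comp (g := gammaWeight (a + 1) c) (f := fun z => (σ : ℂ) + z) z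
      (differentiableAt_gammaWeight (by simp; linarith [hz.1])
        (by simp; linarith [hz.2])) (by fun_prop)).differentiableWithinAt
  have hφb : ∀ z : ℂ, 0 ≤ z.re → z.re ≤ 1 → ‖φ z‖ ≤ M * Real.exp (-d * |z.im|) := by
    intro z hz0 hz1
    have := hb (σ + z) (by simpa using hz0) (by simpa using hz1)
    rw [add_im, ofReal_im, zero_add] at this
    refine this.trans ?_
    have := min_le_left δ (δ' / 2)
    gcongr
  have hφc : ∀ x : ℝ, 0 ≤ x → x ≤ 1 → Continuous fun y : ℝ => φ (x + I * y) := by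
    intro x h0 h1
    refine hφd.continuousOn.comp_continuous (by fun_prop) fun y => ?_
    simp [h0, h1]
  have hshift := fun i : Fin (n + 1) => integral_insertionFactor_shift hg i hφd hψc hd0 hφb hψb
  have hInt1 := fun i : Fin (n + 1) => (integral_insertionFactor_fubini hg i zero_le_one le_rfl
    (hφc 1 zero_le_one le_rfl) hψc hd0
      (fun y => by simpa using hφb ((1 : ℝ) + I * y) (by simp) (by simp)) hψb).1
  have hInt0 := fun i : Fin (n + 1) => (integral_insertionFactor_fubini hg i le_rfl zero_le_one
    (hφc 0 le_rfl zero_le_one) hψc hd0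
      (fun y => by simpa using hφb ((0 : ℝ) + I * y) (by simp) (by simp)) hψb).1
  have hsum := Finset.sum_congr (s₁ := univ) rfl fun i _ => hshift i
  rw [← integral_finsetSum _ fun i _ => hInt1 i, ← integral_finsetSum _ fun i _ => hInt0 i]
    at hsum
  have hI := fun t => integrable_gammaMoment hg (n + 1) h0 h1 hc t
  have hprod : ∀ (t : ℂ) (y : Fin (n + 1) → ℝ),
      (∏ u, (t - (σ + I * y u)) * gammaWeight a c (σ + I * y u)) *
        gammaKernel g (fun u => I * y u) = (∏ u, (t - (σ + I * y u))) *
        ((∏ u, W (y u)) * gammaKernel g (fun u => I * y u)) := fun t y => by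
    rw [prod_mul_distrib, mul_assoc]
  have hL : ∀ (i : Fin (n + 1)) (y : Fin (n + 1) → ℝ),
      φ ((1 : ℝ) + I * y i) * insertionFactor g ((1 : ℝ) + I * y i)
        (fun j => y (i.succAbove j)) *
        ((∏ j, ψ (y (i.succAbove j))) * gammaKernel g fun j => I * y (i.succAbove j)) =
      Complex.exp c * ((∏ u, W (y u)) * gammaKernel g (fun u => I * y u)) *
        ((σ + I * y i) * ∏ j ∈ univ.erase i, (t - (σ + I * y j)) *
          (((σ + I * y i) - (σ + I * y j) + g) / ((σ + I * y i) - (σ + I * y j)))) := by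
    intro i y
    have e1 : φ ((1 : ℝ) + I * y i) = Complex.exp c * ((σ + I * y i) * W (y i)) := by
      rw [hφ, hW]
      simp only
      rw [← gammaWeight_add_one_right (fun h => by
        have := congrArg Complex.re h
        simp at this
        exact h0.ne' this)]
      congr 1
      push_cast
      ring
    rw [mul_assoc, mul_comm (∏ j, ψ _), ← mul_assoc (insertionFactor _ _ _),
      insertionFactor_one_mul hg i y, e1, prod_erase_eq_prod_succAbove,
      Fin.prod_univ_succAbove (fun u => W (y u)) i]
    simp only [hψ, prod_mul_distrib, add_sub_add_left_eq_sub]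
    ring
  have hR : ∀ (i : Fin (n + 1)) (y : Fin (n + 1) → ℝ),
      φ ((0 : ℝ) + I * y i) * insertionFactor g ((0 : ℝ) + I * y i)
        (fun j => y (i.succAbove j)) *
        ((∏ j, ψ (y (i.succAbove j))) * gammaKernel g fun j => I * y (i.succAbove j)) =
      ((∏ u, W (y u)) * gammaKernel g (fun u => I * y u)) *
        ((a - (σ + I * y i)) * ∏ j ∈ univ.erase i, (t - (σ + I * y j)) *
          (((σ + I * y i) - (σ + I * y j) - g) / ((σ + I * y i) - (σ + I * y j)))) := by
    intro i y
    have e1 : φ ((0 : ℝ) + I * y i) = (a - (σ + I * y i)) * W (y i) := by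
      rw [hφ, hW]
      simp only
      rw [← gammaWeight_add_one_left (fun h => by
        have := congrArg Complex.re h
        simp at this
        exact h1.ne' this), ofReal_zero, zero_add]
    rw [mul_assoc, mul_comm (∏ j, ψ _), ← mul_assoc (insertionFactor _ _ _),
      insertionFactor_zero_mul hg i y, e1, prod_erase_eq_prod_succAbove,
      Fin.prod_univ_succAbove (fun u => W (y u)) i]
    simp only [hψ, prod_mul_distrib, add_sub_add_left_eq_sub]
    ring
  simp_rw [hL, hR, ← mul_sum] at hsum
  have hLs : ∀ y : Fin (n + 1) → ℝ,
      Complex.exp c * ((∏ u, W (y u)) * gammaKernel g (fun u => I * y u)) *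
        ∑ i, ((σ + I * y i) * ∏ j ∈ univ.erase i, (t - (σ + I * y j)) *
          (((σ + I * y i) - (σ + I * y j) + g) / ((σ + I * y i) - (σ + I * y j)))) =
      Complex.exp c * (t * (((∏ u, (t + g - (σ + I * y u)) * gammaWeight a c (σ + I * y u)) *
        gammaKernel g (fun u => I * y u) -
        (∏ u, (t - (σ + I * y u)) * gammaWeight a c (σ + I * y u)) *
        gammaKernel g (fun u => I * y u)) / g) - (n + 1 : ℕ) *
        ((∏ u, (t - (σ + I * y u)) * gammaWeight a c (σ + I * y u)) *
        gammaKernel g (fun u => I * y u))) := by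
    intro y
    simp_rw [hprod]
    by_cases hy : Function.Injective fun u => (I * y u : ℂ)
    · rw [sum_mul_prod_sub_mul_div (s := fun u => σ + I * y u)
        (fun u v huv => hy (by simpa using huv)) hg0]
      ring
    · rw [gammaKernel_eq_zero g hy]
      simp
  have hRs : ∀ y : Fin (n + 1) → ℝ,
      ((∏ u, W (y u)) * gammaKernel g (fun u => I * y u)) *
        ∑ i, ((a - (σ + I * y i)) * ∏ j ∈ univ.erase i, (t - (σ + I * y j)) *
          (((σ + I * y i) - (σ + I * y j) - g) / ((σ + I * y i) - (σ + I * y j)))) =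
      (t - a) * (((∏ u, (t - g - (σ + I * y u)) * gammaWeight a c (σ + I * y u)) *
        gammaKernel g (fun u => I * y u) -
        (∏ u, (t - (σ + I * y u)) * gammaWeight a c (σ + I * y u)) *
        gammaKernel g (fun u => I * y u)) / g) + (n + 1 : ℕ) *
        ((∏ u, (t - (σ + I * y u)) * gammaWeight a c (σ + I * y u)) *
        gammaKernel g (fun u => I * y u)) := by
    intro y
    simp_rw [hprod]
    by_cases hy : Function.Injective fun u => (I * y u : ℂ)
    · rw [sum_sub_mul_prod_sub_mul_div (s := fun u => σ + I * y u)
        (fun u v huv => hy (by simpa using huv)) hg0]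
      ring
    · rw [gammaKernel_eq_zero g hy]
      simp
  simp_rw [hLs, hRs] at hsum
  have hG : ∀ t, gammaMoment g (n + 1) a c σ t = ∫ y : Fin (n + 1) → ℝ,
      (∏ u, (t - (σ + I * y u)) * gammaWeight a c (σ + I * y u)) *
        gammaKernel g (fun u => I * y u) := fun t => rfl
  generalize hGdef : (fun (t : ℂ) (y : Fin (n + 1) → ℝ) =>
      (∏ u, (t - (σ + I * y u)) * gammaWeight a c (σ + I * y u)) *
        gammaKernel g (fun u => I * y u)) = G at *
  have e : ∀ (t : ℂ) (y : Fin (n + 1) → ℝ),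
      (∏ u, (t - (σ + I * y u)) * gammaWeight a c (σ + I * y u)) *
        gammaKernel g (fun u => I * y u) = G t y := fun t y => by rw [← hGdef]
  simp_rw [e] at hsum hI hG
  have hΔ : ∀ s, Integrable fun y => (G s y - G t y) / g := fun s =>
    ((hI s).sub (hI t)).div_const _
  have hΔi : ∀ s, ∫ y, (G s y - G t y) / g = ((∫ y, G s y) - ∫ y, G t y) / g := fun s => by
    rw [integral_div, integral_sub (hI s) (hI t)]
  rw [integral_const_mul, integral_sub ((hΔ _).const_mul _) ((hI _).const_mul _),
    integral_add ((hΔ _).const_mul _) ((hI _).const_mul _), integral_const_mul,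
    integral_const_mul, integral_const_mul, hΔi, hΔi] at hsum
  simp_rw [hG]
  exact hsum

theorem sum_neg_one_pow_mul_choose_mul_prod (l : ℕ) (b : Fin l → ℂ) {g : ℂ} (hg : g ≠ 0) :
    ∑ k ∈ range (l + 1), ((-1 : ℤ) ^ (l - k) * l.choose k) • ∏ u, (b u + g * k) =
      l.factorial * g ^ l := by
  set P : Polynomial ℂ := ∏ u, (Polynomial.C g * Polynomial.X + Polynomial.C (b u)) with hP
  have hdeg : P.natDegree = l := by
    rw [hP, Polynomial.natDegree_prod _ _ fun u _ => by
      apply Polynomial.ne_zero_of_natDegree_gt (n := 0)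
      rw [Polynomial.natDegree_linear hg]
      exact one_pos]
    simp [Polynomial.natDegree_linear hg]
  have hlead : P.leadingCoeff = g ^ l := by
    rw [hP, Polynomial.leadingCoeff_prod]
    simp [Polynomial.leadingCoeff_linear hg]
  have h := congrFun P.fwdDiff_iter_degree_eq_factorial 0
  rw [fwdDiff_iter_eq_sum_shift, hdeg] at h
  simp only [hP, Polynomial.eval_prod] at h
  rw [← hP, hlead] at h
  simp at h
  simp [add_comm (b _)]
  rw [h]
  ring

theorem iterate_fwdDiff_relation {E a g l : ℂ} {q : ℤ → ℂ}
    (h : ∀ n : ℤ, E * ((a + g * n) * (q (n + 1) - q n) - l * g * q n) =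
      -(g * n) * (q n - q (n - 1)) + l * g * q n) (k : ℕ) (n : ℤ) :
    E * (a + g * (n + k)) * (fwdDiff 1)^[k + 1] q n =
      (1 + E) * (l - k) * g * (fwdDiff 1)^[k] q n -
        g * n * (fwdDiff 1)^[k + 1] q (n - 1) := by
  induction k generalizing n with
  | zero =>
    simp [fwdDiff]
    linear_combination h n
  | succ k ih =>
    have h1 := ih (n + 1)
    have h0 := ih n
    rw [Function.iterate_succ_apply' _ (k + 1)]
    have e1 : ∀ m, fwdDiff 1 ((fwdDiff 1)^[k + 1] q) m =
      (fwdDiff 1)^[k + 1] q (m + 1) - (fwdDiff 1)^[k + 1] q m := fun m => rfl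
    have e2 : (fwdDiff 1)^[k + 1] q n = (fwdDiff 1)^[k] q (n + 1) - (fwdDiff 1)^[k] q n := by
      rw [Function.iterate_succ_apply']; rfl
    rw [e1, e1, sub_add_cancel]
    rw [add_sub_cancel_right] at h1
    push_cast at h1 h0 ⊢
    linear_combination h1 - h0 - ((1 + E) * (l - k) * g) * e2

theorem prod_mul_iterate_fwdDiff {E a g l : ℂ} {q : ℤ → ℂ}
    (h : ∀ n : ℤ, E * ((a + g * n) * (q (n + 1) - q n) - l * g * q n) =
      -(g * n) * (q n - q (n - 1)) + l * g * q n) (k : ℕ) :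
    E ^ k * (∏ j ∈ range k, (a + g * j)) * (fwdDiff 1)^[k] q 0 =
      (1 + E) ^ k * (∏ j ∈ range k, (l - j)) * g ^ k * q 0 := by
  induction k with
  | zero => simp
  | succ k ih =>
    have := iterate_fwdDiff_relation h k 0
    simp at this
    rw [prod_range_succ, prod_range_succ, pow_succ E]
    simp only [Function.iterate_succ_apply] at *
    linear_combination (E ^ k * ∏ j ∈ range k, (a + g * j)) * this + ((1 + E) * (l - k) * g) * ih

/-- The recurrence in the parameter `a`. -/
theorem gammaIntegral_add_one {g : ℝ} (hg : 0 < g) (l : ℕ) {a c : ℂ} {σ : ℝ} (h0 : 0 < σ)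
    (h1 : σ < a.re) (hc : |c.im| < π) :
    Complex.exp c ^ l * (∏ k ∈ range l, (a + g * k)) * gammaIntegral g l a c σ =
      (1 + Complex.exp c) ^ l * gammaIntegral g l (a + 1) c σ := by
  have hg0 : (g : ℂ) ≠ 0 := by exact_mod_cast hg.ne'
  set q : ℤ → ℂ := fun n => gammaMoment g l a c σ (a + g * n) with hq
  have hrel : ∀ n : ℤ, Complex.exp c * ((a + g * n) * (q (n + 1) - q n) - l * g * q n) =
      -(g * n) * (q n - q (n - 1)) + l * g * q n := by
    intro n
    have := gammaMoment_relation hg l h0 h1 hc (a + g * n)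
    have e1 : a + g * n + g = a + g * (n + 1 : ℤ) := by push_cast; ring
    have e2 : a + g * n - g = a + g * (n - 1 : ℤ) := by push_cast; ring
    rw [e1, e2] at this
    change Complex.exp c * ((a + g * n) * ((q (n + 1) - q n) / g) - l * q n) =
      (a + g * n - a) * ((q (n - 1) - q n) / g) + l * q n at this
    field_simp at this
    linear_combination this
  have h := prod_mul_iterate_fwdDiff hrel l
  have hfac : ∏ j ∈ range l, ((l : ℂ) - j) = l.factorial := by
    rw [← Finset.prod_range_add_one_eq_factorial, ← Finset.prod_range_reflect]
    push_cast
    refine prod_congr rfl fun j hj => ?_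
    have : j < l := by simpa using hj
    rw [Nat.sub_sub, Nat.cast_sub (by omega)]
    push_cast
    ring
  have hq0 : q 0 = gammaIntegral g l (a + 1) c σ := by
    simp only [hq, gammaMoment, gammaIntegral, Int.cast_zero, mul_zero, add_zero]
    congr 1
    ext y
    rw [gammaWeight_add_one_left]
    rintro rfl
    simp at h1
  have hd : (fwdDiff 1)^[l] q 0 = l.factorial * g ^ l * gammaIntegral g l a c σ := by
    rw [fwdDiff_iter_eq_sum_shift]
    simp only [hq, gammaMoment, gammaIntegral, kernelIntegral]
    simp_rw [zsmul_eq_mul, ← integral_const_mul]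
    rw [← integral_finsetSum _ fun k _ => (integrable_gammaMoment hg l h0 h1 hc _).const_mul _]
    congr 1
    ext y
    rw [← sum_neg_one_pow_mul_choose_mul_prod l (fun u => a - (σ + I * y u)) hg0, sum_mul]
    refine sum_congr rfl fun k _ => ?_
    have e : ∏ u, (a + g * ((0 + k • 1 : ℤ) : ℂ) - (σ + I * y u)) =
        ∏ u, (a - (σ + I * y u) + g * k) := prod_congr rfl fun u _ => by
      simp
      ring
    rw [prod_mul_distrib, zsmul_eq_mul, e]
    ring
  rw [hd, hq0, hfac] at h
  have hl : ((l.factorial : ℂ) * g ^ l) ≠ 0 :=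
    mul_ne_zero (by exact_mod_cast l.factorial_ne_zero) (pow_ne_zero _ hg0)
  apply mul_left_cancel₀ hl
  linear_combination h

theorem vertical_sub_half_ne_zero (y : ℝ) :
    ((1 : ℝ) + I * y - 1 / 2 : ℂ) ≠ 0 ∧ ((0 : ℝ) + I * y - 1 / 2 : ℂ) ≠ 0 := by
  constructor <;> intro h <;> have := congrArg Complex.re h <;> norm_num at this

theorem inv_vertical_sub_half_sub_inv (y : ℝ) :
    ((1 : ℝ) + I * y - 1 / 2 : ℂ)⁻¹ - ((0 : ℝ) + I * y - 1 / 2 : ℂ)⁻¹ =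
      ((4 * (1 + (2 * y) ^ 2)⁻¹ : ℝ) : ℂ) := by
  obtain ⟨h1, h0⟩ := vertical_sub_half_ne_zero y
  have h2 : ((1 + (2 * y) ^ 2 : ℝ) : ℂ) ≠ 0 := by
    exact_mod_cast (by positivity : (0 : ℝ) < 1 + (2 * y) ^ 2).ne'
  rw [inv_sub_inv h1 h0]
  push_cast at *
  rw [← div_eq_mul_inv, div_eq_div_iff (mul_ne_zero h1 h0) h2]
  linear_combination (-4 * (y : ℂ) ^ 2) * I_sq

theorem integrable_four_mul_inv_one_add_two_mul_sq :
    Integrable (fun y : ℝ => 4 * (1 + (2 * y) ^ 2)⁻¹) ∧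
      ∫ y : ℝ, 4 * (1 + (2 * y) ^ 2)⁻¹ = 2 * π := by
  refine ⟨(integrable_inv_one_add_sq.comp_mul_left' two_ne_zero).const_mul 4, ?_⟩
  rw [integral_const_mul, Measure.integral_comp_mul_left (fun y : ℝ => (1 + y ^ 2)⁻¹) 2,
    integral_univ_inv_one_add_sq]
  norm_num
  ring

/-- The residue theorem for a simple pole in the middle of a vertical strip. -/
theorem integral_vertical_residue {P : ℂ → ℂ} {C c : ℝ}
    (hd : DifferentiableOn ℂ P {z | 0 ≤ z.re ∧ z.re ≤ 1}) (hc : 0 < c)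
    (hP : ∀ z : ℂ, 0 ≤ z.re → z.re ≤ 1 → ‖P z‖ ≤ C * Real.exp (-c * |z.im|)) :
    (∫ y : ℝ, P ((1 : ℝ) + I * y) / ((1 : ℝ) + I * y - 1 / 2)) -
      ∫ y : ℝ, P ((0 : ℝ) + I * y) / ((0 : ℝ) + I * y - 1 / 2) = 2 * π * P (1 / 2) := by
  have hC : 0 ≤ C := by simpa using (norm_nonneg _).trans (hP 0 (by simp) (by simp))
  have hInt : ∀ x : ℝ, 0 ≤ x → x ≤ 1 → |x - 1 / 2| = 1 / 2 →
      Integrable fun y : ℝ => P (x + I * y) / (x + I * y - 1 / 2) := by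
    intro x h0 h1 hx
    have hne : ∀ y : ℝ, 1 / 2 ≤ ‖(x + I * y - 1 / 2 : ℂ)‖ := fun y => by
      rw [← hx]
      simpa using abs_re_le_norm (x + I * y - 1 / 2 : ℂ)
    refine ((integrable_exp_neg_mul_abs hc).const_mul (C * 2)).mono' ?_ (.of_forall fun y => ?_)
    · refine (Continuous.div (hd.continuousOn.comp_continuous (by fun_prop) fun y => ?_)
        (by fun_prop) fun y => ?_).aestronglyMeasurable
      · simp [h0, h1]
      · exact norm_pos_iff.1 (lt_of_lt_of_le (by norm_num) (hne y))
    · rw [norm_div]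
      have hb := hP (x + I * y) (by simpa using h0) (by simpa using h1)
      refine (div_le_div₀ ((norm_nonneg _).trans hb) hb (by norm_num) (hne y)).trans_eq ?_
      simp
      ring
  have hi1 := hInt 1 (by norm_num) (by norm_num) (by norm_num [abs_of_pos])
  have hi0 := hInt 0 (by norm_num) (by norm_num) (by norm_num [abs_of_pos])
  obtain ⟨hk, hkv⟩ := integrable_four_mul_inv_one_add_two_mul_sq
  have hnhds : {z : ℂ | 0 ≤ z.re ∧ z.re ≤ 1} ∈ nhds (1 / 2 : ℂ) := by
    have : {z : ℂ | 0 < z.re ∧ z.re < 1} ∈ nhds (1 / 2 : ℂ) :=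
      ((isOpen_lt continuous_const continuous_re).inter
        (isOpen_lt continuous_re continuous_const)).mem_nhds (by norm_num)
    filter_upwards [this] with z hz using ⟨hz.1.le, hz.2.le⟩
  have hsl : ∀ z : ℂ, z ≠ 1 / 2 → dslope P (1 / 2) z = (P z - P (1 / 2)) / (z - 1 / 2) :=
    fun z hz => by rw [dslope_of_ne _ hz, slope_def_field]
  have hdiff : ∀ y : ℝ, dslope P (1 / 2) ((1 : ℝ) + I * y) -
      dslope P (1 / 2) ((0 : ℝ) + I * y) =
      P ((1 : ℝ) + I * y) / ((1 : ℝ) + I * y - 1 / 2) -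
        P ((0 : ℝ) + I * y) / ((0 : ℝ) + I * y - 1 / 2) -
        P (1 / 2) * ((4 * (1 + (2 * y) ^ 2)⁻¹ : ℝ) : ℂ) := by
    intro y
    obtain ⟨h1, h0⟩ := vertical_sub_half_ne_zero y
    rw [hsl _ (sub_ne_zero.1 h1), hsl _ (sub_ne_zero.1 h0), ← inv_vertical_sub_half_sub_inv]
    ring
  have hz := integral_vertical_sub_eq_zero (f := dslope P (1 / 2)) zero_le_one
    ((Complex.differentiableOn_dslope hnhds).2 hd) (fun ε hε => ?_) ?_
  · simp_rw [hdiff] at hz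
    have hsub : Integrable fun y : ℝ => P ((1 : ℝ) + I * y) / ((1 : ℝ) + I * y - 1 / 2) -
        P ((0 : ℝ) + I * y) / ((0 : ℝ) + I * y - 1 / 2) := hi1.sub hi0
    have hk' : Integrable fun y : ℝ => P (1 / 2) * ((4 * (1 + (2 * y) ^ 2)⁻¹ : ℝ) : ℂ) :=
      hk.ofReal.const_mul _
    rw [integral_sub hsub hk', integral_const_mul, integral_complex_ofReal,
      hkv, integral_sub hi1 hi0] at hz
    push_cast at hz ⊢
    linear_combination hz
  · refine ⟨(C + ‖P (1 / 2)‖) / ε + 1, fun z h0 h1 hT => ?_⟩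
    have hpos : 0 < |z.im| := lt_of_lt_of_le (by positivity) hT
    have him : |z.im| ≤ ‖z - 1 / 2‖ := by
      simpa using abs_im_le_norm (z - 1 / 2)
    have hne : z ≠ 1 / 2 := by
      rintro rfl
      simp at him
      norm_num at hpos
    rw [hsl z hne, norm_div, div_le_iff₀ (hpos.trans_le him)]
    have hb := hP z h0 h1
    have : C * Real.exp (-c * |z.im|) ≤ C :=
      mul_le_of_le_one_right hC (Real.exp_le_one_iff.2 (by nlinarith [abs_nonneg z.im]))
    calc ‖P z - P (1 / 2)‖ ≤ C + ‖P (1 / 2)‖ := (norm_sub_le _ _).trans (by linarith)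
      _ ≤ ε * |z.im| := by
        rw [← div_le_iff₀' hε]
        linarith
      _ ≤ ε * ‖z - 1 / 2‖ := by gcongr
  · simp_rw [hdiff]
    exact (hi1.sub hi0).sub (hk.ofReal.const_mul _)

theorem integral_insertionFactor_residue {g : ℝ} (hg : 0 < g) {n : ℕ} (i : Fin (n + 1))
    {φ : ℂ → ℂ} {ψ : ℝ → ℂ} (hφ : DifferentiableOn ℂ φ {z | 0 ≤ z.re ∧ z.re ≤ 1})
    (hψ : Continuous ψ) {M N δ : ℝ} (hδ : 0 < δ)
    (hφb : ∀ z : ℂ, 0 ≤ z.re → z.re ≤ 1 → ‖φ z‖ ≤ M * Real.exp (-δ * |z.im|))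
    (hψb : ∀ y, ‖ψ y‖ ≤ N * Real.exp (-δ * |y|)) :
    (Integrable fun y : Fin (n + 1) → ℝ =>
      φ ((1 : ℝ) + I * y i) / ((1 : ℝ) + I * y i - 1 / 2) * insertionFactor g ((1 : ℝ) + I * y i)
        (fun j => y (i.succAbove j)) *
        ((∏ j, ψ (y (i.succAbove j))) * gammaKernel g fun j => I * y (i.succAbove j))) ∧
    (Integrable fun y : Fin (n + 1) → ℝ =>
      φ ((0 : ℝ) + I * y i) / ((0 : ℝ) + I * y i - 1 / 2) * insertionFactor g ((0 : ℝ) + I * y i)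
        (fun j => y (i.succAbove j)) *
        ((∏ j, ψ (y (i.succAbove j))) * gammaKernel g fun j => I * y (i.succAbove j))) ∧
    (∫ y : Fin (n + 1) → ℝ,
      φ ((1 : ℝ) + I * y i) / ((1 : ℝ) + I * y i - 1 / 2) * insertionFactor g ((1 : ℝ) + I * y i)
        (fun j => y (i.succAbove j)) *
        ((∏ j, ψ (y (i.succAbove j))) * gammaKernel g fun j => I * y (i.succAbove j))) -
    ∫ y : Fin (n + 1) → ℝ,
      φ ((0 : ℝ) + I * y i) / ((0 : ℝ) + I * y i - 1 / 2) * insertionFactor g ((0 : ℝ) + I * y i)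
        (fun j => y (i.succAbove j)) *
        ((∏ j, ψ (y (i.succAbove j))) * gammaKernel g fun j => I * y (i.succAbove j)) =
    2 * π * φ (1 / 2) * ∫ w : Fin n → ℝ, insertionFactor g (1 / 2) w *
      ((∏ j, ψ (w j)) * gammaKernel g fun j => I * w j) := by
  have hM : 0 ≤ M := by simpa using (norm_nonneg _).trans (hφb 0 (by simp) (by simp))
  have hne : ∀ x : ℝ, |x - 1 / 2| = 1 / 2 → ∀ y : ℝ, 1 / 2 ≤ ‖(x + I * y - 1 / 2 : ℂ)‖ :=
    fun x hx y => by
      rw [← hx]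
      simpa using abs_re_le_norm (x + I * y - 1 / 2 : ℂ)
  have hcont : ∀ x : ℝ, 0 ≤ x → x ≤ 1 → |x - 1 / 2| = 1 / 2 →
      Continuous fun y : ℝ => φ (x + I * y) / (x + I * y - 1 / 2) := by
    intro x h0 h1 hx
    refine Continuous.div (hφ.continuousOn.comp_continuous (by fun_prop) fun y => ?_)
        (by fun_prop) fun y => ?_
    · simp [h0, h1]
    · exact norm_pos_iff.1 (lt_of_lt_of_le (by norm_num) (hne x hx y))
  have hbd : ∀ x : ℝ, 0 ≤ x → x ≤ 1 → |x - 1 / 2| = 1 / 2 → ∀ y : ℝ,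
      ‖φ (x + I * y) / (x + I * y - 1 / 2)‖ ≤ (M * 2) * Real.exp (-δ * |y|) := by
    intro x h0 h1 hx y
    rw [norm_div]
    have hb := hφb (x + I * y) (by simpa using h0) (by simpa using h1)
    refine (div_le_div₀ ((norm_nonneg _).trans hb) hb (by norm_num) (hne x hx y)).trans_eq ?_
    simp
    ring
  obtain ⟨i1, j1, e1⟩ := integral_insertionFactor_fubini hg i zero_le_one le_rfl
    (hcont 1 zero_le_one le_rfl (by norm_num [abs_of_pos])) hψ hδ
    (hbd 1 zero_le_one le_rfl (by norm_num [abs_of_pos])) hψb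
  obtain ⟨i0, j0, e0⟩ := integral_insertionFactor_fubini hg i le_rfl zero_le_one
    (hcont 0 le_rfl zero_le_one (by norm_num [abs_of_pos])) hψ hδ
    (hbd 0 le_rfl zero_le_one (by norm_num [abs_of_pos])) hψb
  refine ⟨i1, i0, ?_⟩
  rw [e1, e0, ← integral_sub j1 j0, ← integral_const_mul]
  refine integral_congr_ae (.of_forall fun w => ?_)
  obtain ⟨C, hC, hE⟩ := exists_norm_insertionFactor_le hg n (half_pos hδ)
  have := integral_vertical_residue (P := fun z => φ z * insertionFactor g z w)
    (hφ.mul fun z hz =>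
      (differentiableAt_insertionFactor hg w hz.1 hz.2).differentiableWithinAt)
    (C := M * C * Real.exp (δ / 2 * ∑ j, |w j|)) (c := δ / 2) (half_pos hδ) (by
      intro z hz0 hz1
      rw [norm_mul]
      refine (mul_le_mul (hφb z hz0 hz1) (hE z w hz0 hz1) (norm_nonneg _)
        (by positivity)).trans_eq ?_
      have : Real.exp (-(δ / 2) * |z.im|) = Real.exp (-δ * |z.im|) * Real.exp (δ / 2 * |z.im|) := by
        rw [← Real.exp_add]
        congr 1
        ring
      rw [this]
      ring)
  simp only [div_mul_eq_mul_div]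
  rw [← sub_mul, this]
  ring

theorem insertionFactor_half_mul {g : ℝ} (c : ℂ) {n : ℕ} (w : Fin n → ℝ) :
    insertionFactor g (1 / 2) w * ∏ j, gammaWeight 1 c ((1 / 2 : ℝ) + I * w j) =
      Complex.exp (-(c * g * n)) *
        ∏ j, gammaWeight (1 + 2 * g) c ((1 / 2 + g : ℝ) + I * w j) := by
  rw [show Complex.exp (-(c * g * n)) = ∏ _j : Fin n, Complex.exp (-(c * g)) by
    rw [prod_const, ← Complex.exp_nat_mul]; simp; ring_nf, insertionFactor, ← prod_mul_distrib,
    ← prod_mul_distrib]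
  refine prod_congr rfl fun j _ => ?_
  have h1 : Complex.Gamma (1 / 2 + I * w j) ≠ 0 := Complex.Gamma_ne_zero_of_re_pos (by norm_num)
  have h2 : Complex.Gamma (1 / 2 - I * w j) ≠ 0 := Complex.Gamma_ne_zero_of_re_pos (by norm_num)
  have e1 : (1 : ℂ) - (1 / 2 - I * w j) = 1 / 2 + I * w j := by ring
  have e2 : (1 : ℂ) - (((1 / 2 : ℝ) : ℂ) + I * w j) = 1 / 2 - I * w j := by push_cast; ring
  have e3 : ((1 / 2 : ℝ) : ℂ) + I * w j = 1 / 2 + I * w j := by push_cast; ring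
  have e4 : (1 : ℂ) + 2 * g - (((1 / 2 + g : ℝ) : ℂ) + I * w j) = 1 / 2 - I * w j + g := by
    push_cast; ring
  have e5 : ((1 / 2 + g : ℝ) : ℂ) + I * w j = 1 / 2 + I * w j + g := by push_cast; ring
  rw [gammaRatio, gammaRatio, gammaWeight, gammaWeight, e1, e2, e3, e4, e5, mul_add c _ (g : ℂ),
    Complex.exp_add, Complex.exp_neg]
  have := Complex.exp_ne_zero (c * g)
  generalize Complex.Gamma (1 / 2 + I * w j) = A at *
  generalize Complex.Gamma (1 / 2 - I * w j) = B at *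
  generalize Complex.Gamma (1 / 2 + I * w j + g) = A' at *
  generalize Complex.Gamma (1 / 2 - I * w j + g) = B' at *
  field_simp

/-- The recurrence in the number of variables, at `a = 1`. -/
theorem gammaIntegral_succ {g : ℝ} (hg : 0 < g) (n : ℕ) {c : ℂ} (hc : |c.im| < π) :
    (1 + Complex.exp c) * gammaIntegral g (n + 1) 1 c (1 / 2) =
      2 * π * Complex.exp c * (Complex.exp (-(c * g * n)) *
        gammaIntegral g n (1 + 2 * g) c (1 / 2 + g)) := by
  have hg0 : (g : ℂ) ≠ 0 := by exact_mod_cast hg.ne'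
  obtain ⟨M, hM, δ, hδ, hb⟩ := exists_norm_gammaWeight_strip_le (a := 2) (c := c)
    (α := 1 / 2) (β := 3 / 2) (by norm_num) (by norm_num) hc
  obtain ⟨N, hN, δ', hδ', hb'⟩ := exists_norm_gammaWeight_line_le (a := 1) (c := c)
    (σ := 1 / 2) (by norm_num) (by norm_num) hc
  set d := min δ δ' with hd
  have hd0 : 0 < d := lt_min hδ hδ'
  set W : ℝ → ℂ := fun y => gammaWeight 1 c ((1 / 2 : ℝ) + I * y) with hW
  set φ : ℂ → ℂ := fun z => -gammaWeight 2 c (1 / 2 + z) with hφ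
  have hWc : Continuous W := continuous_gammaWeight_line c (by norm_num) (by norm_num)
  have hWb : ∀ y, ‖W y‖ ≤ N * Real.exp (-d * |y|) := fun y => by
    refine (hb' y).trans ?_
    have := min_le_right δ δ'
    gcongr
  have hφd : DifferentiableOn ℂ φ {z | 0 ≤ z.re ∧ z.re ≤ 1} := fun z hz =>
    (DifferentiableAt.comp (g := gammaWeight 2 c) (f := fun z => (1 / 2 : ℂ) + z) z
      (differentiableAt_gammaWeight (by norm_num; linarith [hz.1])
        (by norm_num; linarith [hz.2])) (by fun_prop)).neg.differentiableWithinAt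
  have hφb : ∀ z : ℂ, 0 ≤ z.re → z.re ≤ 1 → ‖φ z‖ ≤ M * Real.exp (-d * |z.im|) := by
    intro z hz0 hz1
    have := hb (1 / 2 + z) (by norm_num; linarith) (by norm_num; linarith)
    rw [add_im, show (1 / 2 : ℂ).im = 0 by norm_num, zero_add] at this
    rw [hφ, norm_neg]
    refine this.trans ?_
    have := min_le_left δ δ'
    gcongr
  have hgam : ∀ z : ℂ, z ≠ 1 / 2 → φ z / (z - 1 / 2) = gammaWeight 1 c (1 / 2 + z) := by
    intro z hz
    change -gammaWeight 2 c (1 / 2 + z) / _ = _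
    rw [gammaWeight, gammaWeight, show (2 : ℂ) - (1 / 2 + z) = 1 - (1 / 2 + z) + 1 by ring,
      Complex.Gamma_add_one _ (by
        intro h; apply hz; linear_combination -h), div_eq_iff (sub_ne_zero.2 hz)]
    ring
  have hφ1 : ∀ y : ℝ, φ ((1 : ℝ) + I * y) / ((1 : ℝ) + I * y - 1 / 2) =
      -Complex.exp c * W y := by
    intro y
    have h1 : (1 / 2 + I * y : ℂ) ≠ 0 := fun h => by
      have := congrArg Complex.re h
      norm_num at this
    have h2 : (1 / 2 + I * y : ℂ) ≠ 1 := fun h => by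
      have := congrArg Complex.re h
      norm_num at this
    have h3 := gammaWeight_add_one_right (a := 1) (c := c) h1
    have h4 := gammaWeight_add_one_left (a := 1) (c := c) (z := 1 / 2 + I * y + 1)
      (fun h => h1 (by linear_combination -h))
    rw [hgam _ (sub_ne_zero.1 (vertical_sub_half_ne_zero y).1), hW]
    push_cast
    rw [h4] at h3
    rw [show (1 / 2 + (1 + I * y) : ℂ) = 1 / 2 + I * y + 1 by ring]
    apply mul_left_cancel₀ h1
    linear_combination -h3
  have hφ0 : ∀ y : ℝ, φ ((0 : ℝ) + I * y) / ((0 : ℝ) + I * y - 1 / 2) = W y := by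
    intro y
    rw [hgam _ (sub_ne_zero.1 (vertical_sub_half_ne_zero y).2), hW]
    push_cast
    rw [zero_add]
  have hφh : φ (1 / 2) = -Complex.exp c := by
    simp only [hφ, gammaWeight]
    norm_num
  have hres := fun i : Fin (n + 1) => integral_insertionFactor_residue hg i hφd hWc hd0 hφb hWb
  have hInt1 := fun i : Fin (n + 1) => (hres i).1
  have hInt0 := fun i : Fin (n + 1) => (hres i).2.1
  have hsum := Finset.sum_congr (s₁ := univ) rfl fun i _ => (hres i).2.2
  rw [sum_sub_distrib, ← integral_finsetSum _ fun i _ => hInt1 i,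
    ← integral_finsetSum _ fun i _ => hInt0 i] at hsum
  have hX : ∀ (i : Fin (n + 1)) (y : Fin (n + 1) → ℝ), ∏ u, W (y u) =
      W (y i) * ∏ j, W (y (i.succAbove j)) := fun i y =>
    Fin.prod_univ_succAbove (fun u => W (y u)) i
  have hL : ∀ (i : Fin (n + 1)) (y : Fin (n + 1) → ℝ),
      φ ((1 : ℝ) + I * y i) / ((1 : ℝ) + I * y i - 1 / 2) *
        insertionFactor g ((1 : ℝ) + I * y i) (fun j => y (i.succAbove j)) *
        ((∏ j, W (y (i.succAbove j))) * gammaKernel g fun j => I * y (i.succAbove j)) =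
      -Complex.exp c * ((∏ u, W (y u)) * gammaKernel g (fun u => I * y u)) *
        ∏ j ∈ univ.erase i, (I * y i - I * y j + g) / (I * y i - I * y j) := by
    intro i y
    rw [mul_assoc, mul_comm (∏ j, W _), ← mul_assoc (insertionFactor _ _ _),
      insertionFactor_one_mul hg i y, hφ1, prod_erase_eq_prod_succAbove, hX i]
    ring
  have hR : ∀ (i : Fin (n + 1)) (y : Fin (n + 1) → ℝ),
      φ ((0 : ℝ) + I * y i) / ((0 : ℝ) + I * y i - 1 / 2) *
        insertionFactor g ((0 : ℝ) + I * y i) (fun j => y (i.succAbove j)) *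
        ((∏ j, W (y (i.succAbove j))) * gammaKernel g fun j => I * y (i.succAbove j)) =
      ((∏ u, W (y u)) * gammaKernel g (fun u => I * y u)) *
        ∏ j ∈ univ.erase i, (I * y i - I * y j + (-g)) / (I * y i - I * y j) := by
    intro i y
    rw [mul_assoc, mul_comm (∏ j, W _), ← mul_assoc (insertionFactor _ _ _),
      insertionFactor_zero_mul hg i y, hφ0, prod_erase_eq_prod_succAbove, hX i]
    simp only [sub_eq_add_neg]
    ring
  have hkey : ∀ (y : Fin (n + 1) → ℝ) {g' : ℂ}, g' ≠ 0 →
      gammaKernel g (fun u => I * y u) * ∑ i, ∏ j ∈ univ.erase i,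
        (I * y i - I * y j + g') / (I * y i - I * y j) =
      gammaKernel g (fun u => I * y u) * (n + 1 : ℕ) := by
    intro y g' hg'
    by_cases hy : Function.Injective fun u => (I * y u : ℂ)
    · rw [sum_prod_sub_add_div hy hg']
    · rw [gammaKernel_eq_zero g hy]
      simp
  simp_rw [hL, hR, ← mul_sum] at hsum
  have hLs : ∀ y : Fin (n + 1) → ℝ,
      -Complex.exp c * ((∏ u, W (y u)) * gammaKernel g (fun u => I * y u)) *
        ∑ i, ∏ j ∈ univ.erase i, (I * y i - I * y j + g) / (I * y i - I * y j) =
      (-Complex.exp c * (n + 1 : ℕ)) * ((∏ u, W (y u)) * gammaKernel g (fun u => I * y u)) := by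
    intro y
    linear_combination (-Complex.exp c * ∏ u, W (y u)) * hkey y hg0
  have hRs : ∀ y : Fin (n + 1) → ℝ,
      ((∏ u, W (y u)) * gammaKernel g (fun u => I * y u)) *
        ∑ i, ∏ j ∈ univ.erase i, (I * y i - I * y j + (-g)) / (I * y i - I * y j) =
      (n + 1 : ℕ) * ((∏ u, W (y u)) * gammaKernel g (fun u => I * y u)) := by
    intro y
    linear_combination (∏ u, W (y u)) * hkey y (neg_ne_zero.2 hg0)
  simp_rw [hLs, hRs] at hsum
  rw [integral_const_mul, integral_const_mul, sum_const, card_univ, Fintype.card_fin,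
    nsmul_eq_mul, hφh] at hsum
  have hfin : ∫ w : Fin n → ℝ, insertionFactor g (1 / 2) w *
      ((∏ j, W (w j)) * gammaKernel g fun j => I * w j) =
      Complex.exp (-(c * g * n)) * gammaIntegral g n (1 + 2 * g) c (1 / 2 + g) := by
    rw [gammaIntegral, kernelIntegral, ← integral_const_mul]
    refine integral_congr_ae (.of_forall fun w => ?_)
    simp only
    rw [← mul_assoc, insertionFactor_half_mul, mul_assoc]
  rw [hfin] at hsum
  have hJ : gammaIntegral g (n + 1) 1 c (1 / 2) = ∫ y : Fin (n + 1) → ℝ,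
    (∏ u, W (y u)) * gammaKernel g (fun u => I * y u) := rfl
  rw [← hJ] at hsum
  have hn : ((n + 1 : ℕ) : ℂ) ≠ 0 := by exact_mod_cast n.succ_ne_zero
  apply mul_left_cancel₀ hn
  linear_combination -hsum

theorem deriv_eq_zero_of_periodic {h : ℂ → ℂ} (hd : DifferentiableOn ℂ h {a | 1 / 2 < a.re})
    (hper : ∀ a : ℂ, 1 / 2 < a.re → h (a + 1) = h a)
    (hb : ∀ α β : ℝ, 1 / 2 < α → ∃ C ≥ 0, ∀ a : ℂ, α ≤ a.re → a.re ≤ β →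
      ‖h a‖ ≤ C * Real.exp |a.im|) {b : ℂ} (hb1 : 1 < b.re) : deriv h b = 0 := by
  have hU : IsOpen {a : ℂ | 1 / 2 < a.re} := isOpen_lt continuous_const continuous_re
  set S : ℂ → ℂ := fun z => Complex.Gamma (1 / 2 + z) * Complex.Gamma (3 / 2 - z) with hS
  set R : ℂ → ℂ := fun z => (h (z + (b - 1 / 2)) - h b) * S z ^ 2 with hR
  have hre : ∀ z : ℂ, (z + (b - 1 / 2)).re = z.re + (b.re - 1 / 2) := fun z => by simp
  have hSd : ∀ z : ℂ, 0 ≤ z.re → z.re ≤ 1 → DifferentiableAt ℂ S z := fun z h0 h1 =>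
    (DifferentiableAt.comp (g := Complex.Gamma) (f := fun z => (1 / 2 : ℂ) + z) z
      (differentiableAt_Gamma_of_re_pos (by norm_num; linarith)) (by fun_prop)).mul
    (DifferentiableAt.comp (g := Complex.Gamma) (f := fun z => (3 / 2 : ℂ) - z) z
      (differentiableAt_Gamma_of_re_pos (by norm_num; linarith)) (by fun_prop))
  have hhd : ∀ z : ℂ, 0 ≤ z.re → z.re ≤ 1 →
      DifferentiableAt ℂ (fun z => h (z + (b - 1 / 2))) z := fun z h0 h1 =>
    DifferentiableAt.comp (g := h) (f := fun z => z + (b - 1 / 2)) z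
      (hd.differentiableAt (hU.mem_nhds (by
        show 1 / 2 < (z + (b - 1 / 2)).re
        rw [hre]; linarith))) (by fun_prop)
  have hRd : DifferentiableOn ℂ R {z | 0 ≤ z.re ∧ z.re ≤ 1} := fun z hz =>
    (((hhd z hz.1 hz.2).sub_const _).mul ((hSd z hz.1 hz.2).pow 2)).differentiableWithinAt
  have hnhds : {z : ℂ | 0 ≤ z.re ∧ z.re ≤ 1} ∈ nhds (1 / 2 : ℂ) := by
    have : {z : ℂ | 0 < z.re ∧ z.re < 1} ∈ nhds (1 / 2 : ℂ) :=
      ((isOpen_lt continuous_const continuous_re).inter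
        (isOpen_lt continuous_re continuous_const)).mem_nhds (by norm_num)
    filter_upwards [this] with z hz using ⟨hz.1.le, hz.2.le⟩
  set P := dslope R (1 / 2) with hP
  have hPd : DifferentiableOn ℂ P {z | 0 ≤ z.re ∧ z.re ≤ 1} :=
    (Complex.differentiableOn_dslope hnhds).2 hRd
  have hR0 : R (1 / 2) = 0 := by simp [hR]
  have hPne : ∀ z, z ≠ 1 / 2 → P z = R z / (z - 1 / 2) := fun z hz => by
    rw [hP, dslope_of_ne _ hz, slope_def_field, hR0, sub_zero]
  obtain ⟨G, hG, hGb⟩ := exists_norm_Gamma_le (α := 1 / 2) (3 / 2) (ε := 1 / 4)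
    (by norm_num) (by norm_num)
  obtain ⟨C, hC, hCb⟩ := hb (b.re - 1 / 2) (b.re + 1 / 2) (by linarith)
  have hRb : ∀ z : ℂ, 0 ≤ z.re → z.re ≤ 1 →
      ‖R z‖ ≤ (C * Real.exp |b.im| + ‖h b‖) * G ^ 4 * Real.exp (-1 * |z.im|) := by
    intro z h0 h1
    have e1 : ‖h (z + (b - 1 / 2)) - h b‖ ≤
        (C * Real.exp |b.im| + ‖h b‖) * Real.exp |z.im| := by
      refine (norm_sub_le _ _).trans ?_
      rw [add_mul]
      refine add_le_add ((hCb _ (by rw [hre]; linarith) (by rw [hre]; linarith)).trans ?_)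
        (le_mul_of_one_le_right (norm_nonneg _) (Real.one_le_exp (abs_nonneg _)))
      rw [mul_assoc, ← Real.exp_add]
      gcongr
      rw [show (z + (b - 1 / 2)).im = z.im + b.im by simp]
      linarith [abs_add_le z.im b.im]
    have e2 := hGb (1 / 2 + z) (by norm_num; linarith) (by norm_num; linarith)
    have e3 := hGb (3 / 2 - z) (by norm_num; linarith) (by norm_num; linarith)
    rw [show (1 / 2 + z).im = z.im by norm_num] at e2
    rw [show (3 / 2 - z).im = -z.im by norm_num, abs_neg] at e3
    have e4 : ‖S z‖ ^ 2 ≤ G ^ 4 * Real.exp (-2 * |z.im|) := by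
      have : ‖S z‖ ≤ G ^ 2 * Real.exp (-1 * |z.im|) := by
        rw [hS, norm_mul]
        refine (mul_le_mul e2 e3 (norm_nonneg _) (by positivity)).trans ?_
        rw [mul_mul_mul_comm, ← pow_two, ← Real.exp_add]
        gcongr
        nlinarith [abs_nonneg z.im, pi_gt_three]
      refine (pow_le_pow_left₀ (norm_nonneg _) this 2).trans_eq ?_
      rw [mul_pow, ← pow_mul, ← Real.exp_nat_mul]
      congr 2
      push_cast
      ring
    rw [hR, norm_mul, norm_pow]
    refine (mul_le_mul e1 e4 (by positivity) (by positivity)).trans_eq ?_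
    rw [mul_mul_mul_comm, ← Real.exp_add]
    congr 2
    ring
  have hcomp : IsCompact {z : ℂ | (0 ≤ z.re ∧ z.re ≤ 1) ∧ (-1 ≤ z.im ∧ z.im ≤ 1)} := by
    have := (isCompact_Icc (a := (0 : ℝ)) (b := 1)).reProdIm (isCompact_Icc (a := (-1 : ℝ)) (b := 1))
    exact this
  obtain ⟨D, hD⟩ := hcomp.exists_bound_of_continuousOn
    (hPd.continuousOn.mono fun z hz => hz.1)
  set B := (C * Real.exp |b.im| + ‖h b‖) * G ^ 4 with hB
  have hB0 : 0 ≤ B := by positivity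
  have hPb : ∀ z : ℂ, 0 ≤ z.re → z.re ≤ 1 →
      ‖P z‖ ≤ (B + |D| * Real.exp 1) * Real.exp (-1 * |z.im|) := by
    intro z h0 h1
    rw [add_mul]
    rcases le_total |z.im| 1 with hz | hz
    · refine (hD z ⟨⟨h0, h1⟩, abs_le.1 hz⟩).trans ((le_abs_self D).trans ?_)
      refine le_add_of_nonneg_of_le (by positivity) ?_
      rw [mul_assoc, ← Real.exp_add]
      exact le_mul_of_one_le_right (abs_nonneg _) (Real.one_le_exp (by linarith))
    · have him : |z.im| ≤ ‖z - 1 / 2‖ := by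
        simpa using abs_im_le_norm (z - 1 / 2)
      have hne : z ≠ 1 / 2 := by
        rintro rfl
        norm_num at hz
      rw [hPne z hne, norm_div]
      refine (div_le_self (norm_nonneg _) (hz.trans him)).trans ((hRb z h0 h1).trans ?_)
      exact le_add_of_nonneg_right (by positivity)
  have hres := integral_vertical_residue hPd one_pos hPb
  have hSone : ∀ y : ℝ, S ((1 : ℝ) + I * y) / ((1 : ℝ) + I * y - 1 / 2) =
      -(S ((0 : ℝ) + I * y) / ((0 : ℝ) + I * y - 1 / 2)) := by
    intro y
    obtain ⟨h1, h0⟩ := vertical_sub_half_ne_zero y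
    have e1 : (1 / 2 + (((1 : ℝ) : ℂ) + I * y)) = (1 / 2 + (((0 : ℝ) : ℂ) + I * y)) + 1 := by
      push_cast; ring
    have e2 : (3 / 2 - (((0 : ℝ) : ℂ) + I * y)) = (3 / 2 - (((1 : ℝ) : ℂ) + I * y)) + 1 := by
      push_cast; ring
    have e3 : (1 / 2 + (((0 : ℝ) : ℂ) + I * y)) = ((1 : ℝ) + I * y - 1 / 2 : ℂ) := by
      push_cast; ring
    have e4 : (3 / 2 - (((1 : ℝ) : ℂ) + I * y)) = -((0 : ℝ) + I * y - 1 / 2 : ℂ) := by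
      push_cast; ring
    rw [hS]
    simp only
    rw [e2, e1, e3, e4, Complex.Gamma_add_one _ h1, Complex.Gamma_add_one _ (neg_ne_zero.2 h0)]
    generalize ((1 : ℝ) : ℂ) + I * y - 1 / 2 = p at h1 ⊢
    generalize ((0 : ℝ) : ℂ) + I * y - 1 / 2 = q at h0 ⊢
    field_simp
  have heq : ∀ y : ℝ, P ((1 : ℝ) + I * y) / ((1 : ℝ) + I * y - 1 / 2) =
      P ((0 : ℝ) + I * y) / ((0 : ℝ) + I * y - 1 / 2) := by
    intro y
    obtain ⟨h1, h0⟩ := vertical_sub_half_ne_zero y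
    rw [hPne _ (sub_ne_zero.1 h1), hPne _ (sub_ne_zero.1 h0)]
    have e : (((1 : ℝ) : ℂ) + I * y + (b - 1 / 2)) = (((0 : ℝ) : ℂ) + I * y + (b - 1 / 2)) + 1 := by
      push_cast; ring
    have e' := congrArg (· ^ 2) (hSone y)
    simp only [div_pow, neg_sq] at e'
    rw [div_div, div_div, ← pow_two, ← pow_two, hR]
    simp only
    rw [e, hper _ (by rw [hre]; simp; linarith), mul_div_assoc, mul_div_assoc, e']
  simp_rw [heq, sub_self] at hres
  have hP0 : P (1 / 2) = 0 := by
    have : (2 * π : ℂ) ≠ 0 := by exact_mod_cast two_pi_pos.ne'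
    exact (mul_eq_zero.1 hres.symm).resolve_left this
  rw [hP, dslope_same] at hP0
  have hder : HasDerivAt R (deriv h b) (1 / 2) := by
    have hb' : (1 / 2 : ℂ) + (b - 1 / 2) = b := by ring
    have h1 : HasDerivAt h (deriv h b) ((1 / 2 : ℂ) + (b - 1 / 2)) := by
      rw [hb']
      exact (hd.differentiableAt (hU.mem_nhds (by
        show 1 / 2 < b.re
        linarith))).hasDerivAt
    have h2 := ((h1.comp_add_const (1 / 2) (b - 1 / 2)).sub_const (h b)).mul
      ((hSd (1 / 2) (by norm_num) (by norm_num)).hasDerivAt.pow 2)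
    refine h2.congr_deriv ?_
    have hS1 : S (1 / 2) = 1 := by
      simp only [hS]
      norm_num
    simp only [Pi.pow_apply, hS1, hb', sub_self]
    ring
  rw [← hP0, hder.deriv]

theorem eq_apply_one_of_periodic {h : ℂ → ℂ} (hd : DifferentiableOn ℂ h {a | 1 / 2 < a.re})
    (hper : ∀ a : ℂ, 1 / 2 < a.re → h (a + 1) = h a)
    (hb : ∀ α β : ℝ, 1 / 2 < α → ∃ C ≥ 0, ∀ a : ℂ, α ≤ a.re → a.re ≤ β →
      ‖h a‖ ≤ C * Real.exp |a.im|) {a : ℂ} (ha : 1 / 2 < a.re) : h a = h 1 := by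
  have hV : IsOpen {a : ℂ | 1 < a.re} := isOpen_lt continuous_const continuous_re
  have hconn : IsPreconnected {a : ℂ | 1 < a.re} :=
    (convex_halfSpace_re_gt 1).isPreconnected
  rw [← hper a ha, ← hper 1 (by norm_num)]
  refine hV.is_const_of_deriv_eq_zero hconn (hd.mono fun z hz => ?_)
    (fun z hz => deriv_eq_zero_of_periodic hd hper hb hz) ?_ ?_
  · exact lt_trans (by norm_num) (Set.mem_ofPred.1 hz)
  · show 1 < (a + 1).re
    simp
    linarith
  · show 1 < (1 + 1 : ℂ).re
    norm_num

theorem differentiableAt_kernelIntegral_gammaWeight {g : ℝ} (hg : 0 < g) (l : ℕ) {A C Z : ℂ → ℂ}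
    (hA : Differentiable ℂ A) (hC : Differentiable ℂ C) (hZ : Differentiable ℂ Z) {p : ℂ}
    (h0 : 0 < (Z p).re) (h1 : (Z p).re < (A p).re) (hc : |(C p).im| < π) :
    DifferentiableAt ℂ
      (fun p => kernelIntegral g l fun y => gammaWeight (A p) (C p) (Z p + I * y)) p := by
  set α := min (Z p).re ((A p).re - (Z p).re) / 2 with hα
  have hα1 : α < (Z p).re := by
    have := min_le_left (Z p).re ((A p).re - (Z p).re)
    linarith
  have hα2 : α < (A p).re - (Z p).re := by
    have := min_le_right (Z p).re ((A p).re - (Z p).re)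
    linarith
  have hα0 : 0 < α := half_pos (lt_min h0 (sub_pos.2 h1))
  set η := (π - |(C p).im|) / 2 with hη
  have hη0 : 0 < η := by linarith
  set R := |(C p).re| + |(A p).im| + |(Z p).im| + 1 with hR
  have hR0 : 0 < R := by positivity
  have cA := hA.continuous
  have cC := hC.continuous
  have cZ := hZ.continuous
  have hev : ∀ᶠ q in nhds p, (α < (Z q).re ∧ (Z q).re < (A p).re + 1) ∧
      (α < (A q).re - (Z q).re ∧ (A q).re - (Z q).re < (A p).re + 1) ∧
      (|(C q).re| < R ∧ |(C q).im| < π - η ∧ |(A q).im| < R) ∧ |(Z q).im| < R := by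
    refine ((ContinuousAt.eventually_lt ?_ ?_ ?_).and (ContinuousAt.eventually_lt ?_ ?_ ?_)).and
      (((ContinuousAt.eventually_lt ?_ ?_ ?_).and (ContinuousAt.eventually_lt ?_ ?_ ?_)).and
      (((ContinuousAt.eventually_lt ?_ ?_ ?_).and ((ContinuousAt.eventually_lt ?_ ?_ ?_).and
        (ContinuousAt.eventually_lt ?_ ?_ ?_))).and (ContinuousAt.eventually_lt ?_ ?_ ?_))) <;>
    first
    | exact Continuous.continuousAt (by fun_prop)
    | linarith [abs_nonneg (C p).re, abs_nonneg (A p).im, abs_nonneg (Z p).im]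
  obtain ⟨r, hr, hball⟩ := Metric.eventually_nhds_iff_ball.1 hev
  obtain ⟨M, hM, hb⟩ := exists_norm_gammaWeight_le ((A p).re + 1) hα0 hη0 hR0.le
  refine differentiableAt_kernelIntegral (r := r) (δ := η / 2) (M := M * Real.exp (η / 2 * R))
    hg l hr (by positivity) (fun y q hq => ?_) (fun q hq => ?_) (fun q hq y => ?_)
  · obtain ⟨⟨z1, z2⟩, ⟨a1, a2⟩, -⟩ := hball q hq
    have e1 : DifferentiableAt ℂ Complex.Gamma (Z q + I * y) :=
      differentiableAt_Gamma_of_re_pos (by simp; linarith)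
    have e2 : DifferentiableAt ℂ Complex.Gamma (A q - (Z q + I * y)) :=
      differentiableAt_Gamma_of_re_pos (by simp; linarith)
    have e3 := DifferentiableAt.comp (g := Complex.Gamma) (f := fun q => Z q + I * y) q e1
      (by fun_prop)
    have e4 := DifferentiableAt.comp (g := Complex.Gamma) (f := fun q => A q - (Z q + I * y)) q e2
      (by fun_prop)
    have e5 : DifferentiableAt ℂ (fun q => Complex.exp (C q * (Z q + I * y))) q := by fun_prop
    exact ((e5.mul e3).mul e4).differentiableWithinAt
  · obtain ⟨⟨z1, z2⟩, ⟨a1, a2⟩, -⟩ := hball q hq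
    rw [continuous_iff_continuousAt]
    intro y
    exact ContinuousAt.comp (f := fun y : ℝ => Z q + I * y)
      (differentiableAt_gammaWeight (by simp; linarith) (by simp; linarith)).continuousAt
      (by fun_prop)
  · obtain ⟨⟨z1, z2⟩, ⟨a1, a2⟩, ⟨c1, c2, a3⟩, z3⟩ := hball q hq
    refine (hb (A q) (C q) (Z q + I * y) (by simp; linarith) (by simp; linarith)
      (by simp; linarith) (by simp; linarith) c1.le c2.le a3.le).trans ?_
    rw [mul_assoc, ← Real.exp_add]
    gcongr
    have : |y| ≤ |(Z q + I * y).im| + R := by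
      have := abs_sub ((Z q + I * y).im) ((Z q).im)
      simp at this ⊢
      linarith
    nlinarith

theorem kernelIntegral_comp_add (g : ℝ) (l : ℕ) (φ : ℝ → ℂ) (t : ℝ) :
    kernelIntegral g l (fun y => φ (y + t)) = kernelIntegral g l φ := by
  rw [kernelIntegral, kernelIntegral, ← integral_add_right_eq_self
    (fun y : Fin l → ℝ => (∏ u, φ (y u)) * gammaKernel g (fun u => I * y u)) (fun _ => t)]
  simp only [Pi.add_apply, gammaKernel]
  have (y : Fin l → ℝ) (u v : Fin l) :
      I * ((y u + t : ℝ) : ℂ) - I * ((y v + t : ℝ) : ℂ) = I * y u - I * y v := by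
    push_cast
    ring
  simp only [this]

/-- The contour can be moved inside the strip `0 < σ < re a`. -/
theorem gammaIntegral_eq_of_lt {g : ℝ} (hg : 0 < g) (l : ℕ) {a c : ℂ} {σ τ : ℝ} (h0 : 0 < σ)
    (h1 : σ < a.re) (h0' : 0 < τ) (h1' : τ < a.re) (hc : |c.im| < π) :
    gammaIntegral g l a c σ = gammaIntegral g l a c τ := by
  set f : ℂ → ℂ := fun ζ => kernelIntegral g l fun y => gammaWeight a c (ζ + I * y) with hf
  have hd : ∀ ζ : ℂ, 0 < ζ.re → ζ.re < a.re → DifferentiableAt ℂ f ζ := fun ζ z0 z1 =>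
    differentiableAt_kernelIntegral_gammaWeight (A := fun _ => a) (C := fun _ => c)
      (Z := fun ζ => ζ) hg l (by fun_prop) (by fun_prop) (by fun_prop) z0 z1 hc
  have hper : ∀ (ζ : ℂ) (t : ℝ), f (ζ + I * t) = f ζ := fun ζ t => by
    rw [hf]
    simp only
    rw [← kernelIntegral_comp_add g l (fun y => gammaWeight a c (ζ + I * y)) t]
    congr 1
    ext y
    congr 1
    push_cast
    ring
  have hd0 : ∀ ζ : ℂ, 0 < ζ.re → ζ.re < a.re → deriv f ζ = 0 := fun ζ z0 z1 => by
    have e1 : HasDerivAt (fun t : ℂ => ζ + I * t) I ((0 : ℝ) : ℂ) := by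
      simpa using ((hasDerivAt_id ((0 : ℝ) : ℂ)).const_mul I).const_add ζ
    have e2 : HasDerivAt f (deriv f ζ) (ζ + I * ((0 : ℝ) : ℂ)) := by
      simpa using (hd ζ z0 z1).hasDerivAt
    have e3 := (HasDerivAt.comp (h₂ := f) (h := fun t : ℂ => ζ + I * t) _ e2 e1).comp_ofReal
    have e4 : HasDerivAt (fun _ : ℝ => f ζ) (deriv f ζ * I) 0 := by
      refine e3.congr_of_eventuallyEq (.of_forall fun t => ?_)
      exact (hper ζ t).symm
    simpa using e4.unique (hasDerivAt_const _ _)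
  set S : Set ℂ := {ζ | 0 < ζ.re ∧ ζ.re < a.re} with hS
  have hSo : IsOpen S := (isOpen_lt continuous_const continuous_re).inter
    (isOpen_lt continuous_re continuous_const)
  have hSc : IsPreconnected S :=
    ((convex_halfSpace_re_gt 0).inter (convex_halfSpace_re_lt a.re)).isPreconnected
  exact hSo.is_const_of_deriv_eq_zero hSc
    (fun z hz => (hd z hz.1 hz.2).differentiableWithinAt) (fun z hz => hd0 z hz.1 hz.2)
    (by simp [hS, h0, h1]) (by simp [hS, h0', h1'])

/-- The closed form of `gammaIntegral g l a c σ`. -/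
noncomputable def gammaValue (g : ℝ) (l : ℕ) (a c : ℂ) : ℂ :=
  (2 * π) ^ l * Complex.exp (c * (g * (l - 1) / 2 + a) * l) *
    (1 + Complex.exp c) ^ (-(l * (a + g * (l - 1)))) *
    ∏ j ∈ range l, Complex.Gamma (1 + (j + 1) * g) / Complex.Gamma (1 + g) *
      Complex.Gamma (a + g * j)

theorem gammaValue_add_one {g : ℝ} {l : ℕ} {a c : ℂ} (hc : 1 + Complex.exp c ≠ 0)
    (ha : ∀ j ∈ range l, a + g * j ≠ 0) :
    (1 + Complex.exp c) ^ l * gammaValue g l (a + 1) c =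
      Complex.exp c ^ l * (∏ k ∈ range l, (a + g * k)) * gammaValue g l a c := by
  have e1 : ∏ j ∈ range l, Complex.Gamma (1 + (j + 1) * g) / Complex.Gamma (1 + g) *
      Complex.Gamma (a + 1 + g * j) = (∏ k ∈ range l, (a + g * k)) *
      ∏ j ∈ range l, Complex.Gamma (1 + (j + 1) * g) / Complex.Gamma (1 + g) *
      Complex.Gamma (a + g * j) := by
    rw [← prod_mul_distrib]
    refine prod_congr rfl fun j hj => ?_
    rw [add_right_comm, Complex.Gamma_add_one _ (ha j hj)]
    ring
  have e2 : Complex.exp (c * (g * (l - 1) / 2 + (a + 1)) * l) =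
      Complex.exp (c * (g * (l - 1) / 2 + a) * l) * Complex.exp c ^ l := by
    rw [← Complex.exp_nat_mul, ← Complex.exp_add]
    ring_nf
  have e3 : (1 + Complex.exp c) ^ l * (1 + Complex.exp c) ^ (-(l * (a + 1 + g * (l - 1)))) =
      (1 + Complex.exp c) ^ (-(l * (a + g * (l - 1)))) := by
    rw [← cpow_natCast, ← cpow_add _ _ hc]
    ring_nf
  rw [gammaValue, gammaValue, e1, e2, ← e3]
  ring

theorem gammaValue_succ_one {g : ℝ} (hg : 0 < g) (n : ℕ) {c : ℂ} (hc : 1 + Complex.exp c ≠ 0) :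
    (1 + Complex.exp c) * gammaValue g (n + 1) 1 c =
      2 * π * Complex.exp c * (Complex.exp (-(c * g * n)) * gammaValue g n (1 + 2 * g) c) := by
  have hG : Complex.Gamma (1 + g) ≠ 0 :=
    Complex.Gamma_ne_zero_of_re_pos (by simp; linarith)
  have e1 : ∏ j ∈ range (n + 1), Complex.Gamma (1 + (j + 1) * g) / Complex.Gamma (1 + g) *
      Complex.Gamma (1 + g * j) =
      ∏ j ∈ range n, Complex.Gamma (1 + (j + 1) * g) / Complex.Gamma (1 + g) *
      Complex.Gamma (1 + 2 * g + g * j) := by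
    rw [prod_range_succ']
    have : Complex.Gamma (1 + (((0 : ℕ) : ℂ) + 1) * g) / Complex.Gamma (1 + g) *
        Complex.Gamma (1 + g * ((0 : ℕ) : ℂ)) = 1 := by
      simp [hG]
    rw [this, mul_one]
    refine prod_congr rfl fun j _ => ?_
    have e : (1 : ℂ) + 2 * g + g * j = 1 + (((j + 1 : ℕ) : ℂ) + 1) * g := by
      push_cast; ring
    have e' : (1 : ℂ) + g * ((j + 1 : ℕ) : ℂ) = 1 + (j + 1) * g := by
      push_cast; ring
    rw [e, e']
    ring
  have e2 : Complex.exp (c * (g * (((n + 1 : ℕ) : ℂ) - 1) / 2 + 1) * ((n + 1 : ℕ) : ℂ)) =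
      Complex.exp c * Complex.exp (-(c * g * n)) *
        Complex.exp (c * (g * (n - 1) / 2 + (1 + 2 * g)) * n) := by
    rw [← Complex.exp_add, ← Complex.exp_add]
    push_cast
    ring_nf
  have e3 : (1 + Complex.exp c) *
      (1 + Complex.exp c) ^ (-(((n + 1 : ℕ) : ℂ) * (1 + g * (((n + 1 : ℕ) : ℂ) - 1)))) =
      (1 + Complex.exp c) ^ (-(n * (1 + 2 * g + g * ((n : ℂ) - 1)))) := by
    nth_rewrite 1 [← cpow_one (1 + Complex.exp c)]
    rw [← cpow_add _ _ hc]
    push_cast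
    ring_nf
  rw [gammaValue, gammaValue, e1, e2, ← e3]
  ring

theorem one_add_exp_mem_slitPlane {c : ℂ} (hc : |c.im| < π) :
    1 + Complex.exp c ∈ slitPlane := by
  rw [mem_slitPlane_iff]
  by_cases h : c.im = 0
  · left
    simp only [add_re, one_re, Complex.exp_re, h, Real.cos_zero, mul_one]
    positivity
  · right
    simp only [add_im, one_im, Complex.exp_im, zero_add]
    obtain ⟨h1, h2⟩ := abs_lt.1 hc
    refine mul_ne_zero (Real.exp_pos _).ne' ?_
    rcases lt_or_gt_of_ne h with h | h
    · exact (Real.sin_neg_of_neg_of_neg_pi_lt h h1).ne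
    · exact (Real.sin_pos_of_pos_of_lt_pi h h2).ne'

/-- For real `c`, the dependence of `gammaValue` on `a` is explicit. -/
theorem gammaValue_ofReal (g : ℝ) (l : ℕ) (c : ℝ) : ∃ k : ℂ, ∀ a : ℂ,
    gammaValue g l a c = k * (Complex.exp (-(((Real.log (1 + Real.exp c) - c : ℝ) : ℂ) * l * a)) *
      ∏ j ∈ range l, Complex.Gamma (a + g * j)) := by
  have hpos : 0 < 1 + Real.exp c := by positivity
  have e : 1 + Complex.exp c = ((1 + Real.exp c : ℝ) : ℂ) := by push_cast; rfl
  have hne : ((1 + Real.exp c : ℝ) : ℂ) ≠ 0 := by exact_mod_cast hpos.ne'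
  refine ⟨(2 * π) ^ l * Complex.exp (c * (g * (l - 1) / 2) * l) *
    Complex.exp (-((Real.log (1 + Real.exp c) : ℝ) * l * (g * (l - 1)))) *
    ∏ j ∈ range l, Complex.Gamma (1 + (j + 1) * g) / Complex.Gamma (1 + g), fun a => ?_⟩
  rw [gammaValue, e, cpow_def_of_ne_zero hne, ← Complex.ofReal_log hpos.le, prod_mul_distrib]
  have : Complex.exp (c * (g * (l - 1) / 2 + a) * l) *
      Complex.exp ((Real.log (1 + Real.exp c) : ℝ) * -(l * (a + g * (l - 1)))) =
      Complex.exp (c * (g * (l - 1) / 2) * l) *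
      Complex.exp (-((Real.log (1 + Real.exp c) : ℝ) * l * (g * (l - 1)))) *
      Complex.exp (-(((Real.log (1 + Real.exp c) - c : ℝ) : ℂ) * l * a)) := by
    rw [← Complex.exp_add, ← Complex.exp_add, ← Complex.exp_add]
    push_cast
    ring_nf
  rw [mul_assoc ((2 * π : ℂ) ^ l), this]
  ring

theorem exists_norm_gammaIntegral_half_le {g : ℝ} (hg : 0 < g) (l : ℕ) (c : ℝ) {α β ε : ℝ}
    (hα : 1 / 2 < α) (hε : 0 < ε) (hε' : 2 * ε ≤ π / 2) :
    ∃ C ≥ 0, ∀ a : ℂ, α ≤ a.re → a.re ≤ β →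
      ‖gammaIntegral g l a c (1 / 2)‖ ≤ C * Real.exp (-(l * (π / 2 - 2 * ε) * |a.im|)) := by
  obtain ⟨C, hC, h⟩ := exists_norm_gammaWeight_le' (α := min (1 / 2) (α - 1 / 2))
    (max (1 / 2) β) (ε := ε) (lt_min (by norm_num) (by linarith)) hε
  obtain ⟨D, hD, hk⟩ := exists_norm_kernelIntegral_le hg l hε
  refine ⟨D * (C * Real.exp (c / 2)) ^ l, by positivity, fun a h1 h2 => ?_⟩
  have := hk (C * Real.exp (c / 2) * Real.exp (-((π / 2 - 2 * ε) * |a.im|)))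
    (fun y => gammaWeight a c ((1 / 2 : ℝ) + I * y)) (by positivity) (fun y => ?_)
  · refine this.trans_eq ?_
    rw [mul_pow (C * Real.exp (c / 2)), ← Real.exp_nat_mul]
    ring_nf
  · have hz : (((1 / 2 : ℝ) : ℂ) + I * y).re = 1 / 2 := by simp
    have hz' : (((1 / 2 : ℝ) : ℂ) + I * y).im = y := by simp
    have hb := h a c ((1 / 2 : ℝ) + I * y) (by rw [hz]; exact min_le_left _ _)
      (by rw [hz]; exact le_max_left _ _)
      (by rw [hz]; exact (min_le_right _ _).trans (by linarith))
      (by rw [hz]; exact le_trans (by linarith) (le_max_right _ _))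
    rw [hz, hz'] at hb
    refine hb.trans ?_
    rw [mul_assoc C, mul_assoc C, ← Real.exp_add, ← Real.exp_add]
    gcongr
    simp only [ofReal_re, ofReal_im, zero_mul, sub_zero]
    have h3 : |a.im| ≤ |y| + |a.im - y| := by
      have := abs_add_le y (a.im - y)
      rwa [add_sub_cancel] at this
    nlinarith [abs_nonneg (a.im - y), mul_le_mul_of_nonneg_left h3 (sub_nonneg.2 hε')]

theorem gammaIntegral_half_eq_gammaValue {g : ℝ} (hg : 0 < g) (l : ℕ) (c : ℝ)
    (h1 : gammaIntegral g l 1 c (1 / 2) = gammaValue g l 1 c) {a : ℂ} (ha : 1 / 2 < a.re) :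
    gammaIntegral g l a c (1 / 2) = gammaValue g l a c := by
  have hc : |(c : ℂ).im| < π := by simp [pi_pos]
  set θ : ℝ := Real.log (1 + Real.exp c) - c with hθ
  set h : ℂ → ℂ := fun a => gammaIntegral g l a c (1 / 2) *
    Complex.exp (θ * l * a) * ∏ j ∈ range l, (Complex.Gamma (a + g * j))⁻¹ with hh
  have hpos : ∀ b : ℂ, 1 / 2 < b.re → ∀ j : ℕ, 0 < (b + g * j).re := fun b hb j => by
    have : 0 ≤ g * j := by positivity
    simp
    linarith
  have hΓ : ∀ b : ℂ, 1 / 2 < b.re → ∀ j : ℕ, Complex.Gamma (b + g * j) ≠ 0 := fun b hb j =>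
    Complex.Gamma_ne_zero_of_re_pos (hpos b hb j)
  have hexp : Complex.exp θ * Complex.exp c = 1 + Complex.exp c := by
    rw [← Complex.exp_add, hθ]
    have : (0 : ℝ) < 1 + Real.exp c := by positivity
    rw [← ofReal_add, sub_add_cancel, ← ofReal_exp, Real.exp_log this]
    push_cast
    rfl
  have hd : DifferentiableOn ℂ h {a | 1 / 2 < a.re} := fun b hb => by
    have e1 : DifferentiableAt ℂ (fun a => gammaIntegral g l a c (1 / 2)) b :=
      differentiableAt_kernelIntegral_gammaWeight (A := fun a => a) (C := fun _ => (c : ℂ))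
        (Z := fun _ => ((1 / 2 : ℝ) : ℂ)) hg l (by fun_prop) (by fun_prop) (by fun_prop)
        (by simp) (by simpa using hb) hc
    have e2 : DifferentiableAt ℂ (fun a => ∏ j ∈ range l, (Complex.Gamma (a + g * j))⁻¹) b :=
      DifferentiableAt.fun_finsetProd fun j _ =>
        (DifferentiableAt.comp (g := Complex.Gamma) (f := fun a => a + (g * j : ℂ)) b
          (differentiableAt_Gamma_of_re_pos (hpos b hb j)) (by fun_prop)).inv (hΓ b hb j)
    have e3 : DifferentiableAt ℂ (fun a => Complex.exp (θ * l * a)) b := by fun_prop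
    exact ((e1.mul e3).mul e2).differentiableWithinAt
  have hper : ∀ b : ℂ, 1 / 2 < b.re → h (b + 1) = h b := fun b hb => by
    have key := gammaIntegral_add_one hg l (a := b) (σ := 1 / 2) (by norm_num) hb hc
    have hne : Complex.exp c ^ l ≠ 0 := pow_ne_zero _ (Complex.exp_ne_zero _)
    have hne' : ∀ j : ℕ, b + g * j ≠ 0 := fun j h0 => by
      have := hpos b hb j
      rw [h0] at this
      simp at this
    have e1 : ∏ j ∈ range l, (Complex.Gamma (b + g * j))⁻¹ = (∏ j ∈ range l, (b + g * j)) *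
        ∏ j ∈ range l, (Complex.Gamma (b + 1 + g * j))⁻¹ := by
      rw [← prod_mul_distrib]
      refine prod_congr rfl fun j _ => ?_
      rw [add_right_comm, Complex.Gamma_add_one _ (hne' j)]
      field_simp [hne' j, hΓ b hb j]
    have e2 : Complex.exp (θ * l * (b + 1)) =
        Complex.exp (θ * l * b) * Complex.exp θ ^ l := by
      rw [← Complex.exp_nat_mul, ← Complex.exp_add]
      ring_nf
    rw [← hexp, mul_pow] at key
    simp only [hh]
    rw [e1, e2]
    refine mul_left_cancel₀ hne ?_
    linear_combination (-(Complex.exp (θ * l * b) *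
      ∏ j ∈ range l, (Complex.Gamma (b + 1 + g * j))⁻¹)) * key
  have hb : ∀ α β : ℝ, 1 / 2 < α → ∃ C ≥ 0, ∀ a : ℂ, α ≤ a.re → a.re ≤ β →
      ‖h a‖ ≤ C * Real.exp |a.im| := fun α β hα => by
    set ε : ℝ := 1 / (3 * (l + 1)) with hε
    have hε0 : 0 < ε := by positivity
    have hεl : 3 * ε * (l + 1) = 1 := by
      rw [hε]; field_simp
    have hε1 : 3 * ε ≤ 1 := by
      have : (0 : ℝ) ≤ l := by positivity
      nlinarith
    obtain ⟨C, hC, hJ⟩ := exists_norm_gammaIntegral_half_le hg l c (β := β) hα hε0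
      (by linarith [pi_gt_three])
    obtain ⟨D, hD, hG⟩ := exists_norm_inv_Gamma_le α (β + g * l) hε0
    refine ⟨C * Real.exp (|θ| * l * β) * D ^ l, by positivity, fun a h1 h2 => ?_⟩
    have n1 := hJ a h1 h2
    have n2 : ‖Complex.exp (θ * l * a)‖ ≤ Real.exp (|θ| * l * β) := by
      rw [Complex.norm_exp]
      gcongr
      have : (θ * l * a : ℂ).re = θ * l * a.re := by simp
      rw [this]
      have ha0 : 0 ≤ a.re := by linarith
      gcongr
      exact le_abs_self θ
    have n3 : ‖∏ j ∈ range l, (Complex.Gamma (a + g * j))⁻¹‖ ≤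
        D ^ l * Real.exp (l * ((π / 2 + ε) * |a.im|)) := by
      rw [Real.exp_nat_mul, ← mul_pow, norm_prod]
      refine (prod_le_prod (fun _ _ => norm_nonneg _) fun j hj => ?_).trans_eq
        ((prod_const _).trans (by rw [card_range]))
      have hj' : (j : ℝ) ≤ l := by exact_mod_cast (mem_range.1 hj).le
      have hj0 : (0 : ℝ) ≤ j := by positivity
      have := hG (a + g * j) (by simp; nlinarith) (by simp; nlinarith)
      simpa using this
    simp only [hh]
    rw [norm_mul, norm_mul]
    refine (mul_le_mul (mul_le_mul n1 n2 (norm_nonneg _) (by positivity)) n3 (norm_nonneg _)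
      (by positivity)).trans ?_
    have : C * Real.exp (-(l * (π / 2 - 2 * ε) * |a.im|)) * Real.exp (|θ| * l * β) *
        (D ^ l * Real.exp (l * ((π / 2 + ε) * |a.im|))) =
        C * Real.exp (|θ| * l * β) * D ^ l * Real.exp ((3 * ε * l) * |a.im|) := by
      have : Real.exp (-(l * (π / 2 - 2 * ε) * |a.im|)) *
          Real.exp (l * ((π / 2 + ε) * |a.im|)) = Real.exp ((3 * ε * l) * |a.im|) := by
        rw [← Real.exp_add]
        ring_nf
      rw [← this]
      ring
    rw [this]
    gcongr
    exact mul_le_of_le_one_left (abs_nonneg _) (by linarith)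
  have hconst := eq_apply_one_of_periodic hd hper hb ha
  obtain ⟨k, hk⟩ := gammaValue_ofReal g l c
  have hprod : ∀ b : ℂ, 1 / 2 < b.re → (∏ j ∈ range l, (Complex.Gamma (b + g * j))⁻¹) *
      ∏ j ∈ range l, Complex.Gamma (b + g * j) = 1 := fun b hb => by
    rw [← prod_mul_distrib]
    exact prod_eq_one fun j _ => inv_mul_cancel₀ (hΓ b hb j)
  have hee : ∀ b : ℂ, Complex.exp (θ * l * b) * Complex.exp (-(θ * l * b)) = 1 := fun b => by
    rw [← Complex.exp_add, add_neg_cancel, Complex.exp_zero]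
  have hk1 : h 1 = k := by
    simp only [hh]
    rw [h1, hk]
    linear_combination k * Complex.exp (θ * l * 1) * Complex.exp (-(θ * l * 1)) *
      hprod 1 (by norm_num) + k * hee 1
  rw [hk1] at hconst
  rw [hk, ← hconst]
  simp only [hh]
  linear_combination (-gammaIntegral g l a c (1 / 2)) * (Complex.exp (θ * l * a) *
    Complex.exp (-(θ * l * a)) * hprod a ha + hee a)

theorem gammaIntegral_ofReal_eq_gammaValue {g : ℝ} (hg : 0 < g) (l : ℕ) (c : ℝ) :
    ∀ {a : ℂ} {σ : ℝ}, 0 < σ → σ < a.re → gammaIntegral g l a c σ = gammaValue g l a c := by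
  have hc : |(c : ℂ).im| < π := by simp [pi_pos]
  have hne := slitPlane_ne_zero (one_add_exp_mem_slitPlane hc)
  induction l with
  | zero =>
    intro a σ _ _
    simp [gammaIntegral, kernelIntegral, gammaKernel, gammaValue, measureReal_def, volume_pi]
  | succ n ih =>
    intro a σ h0 h1
    have hone : gammaIntegral g (n + 1) 1 c (1 / 2) = gammaValue g (n + 1) 1 c := by
      have := gammaIntegral_succ hg n hc
      rw [ih (by positivity) (by simp; linarith), ← gammaValue_succ_one hg n hne] at this
      exact mul_left_cancel₀ hne this
    have hne' : ∀ j : ℕ, a + g * j ≠ 0 := fun j h => by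
      have h2 : 0 ≤ g * j := by positivity
      have h3 : (a + g * j).re = a.re + g * j := by simp
      rw [h, zero_re] at h3
      linarith
    have key := gammaIntegral_add_one hg (n + 1) h0 h1 hc
    rw [gammaIntegral_eq_of_lt (a := a + 1) (τ := 1 / 2) hg (n + 1) h0 (by simp; linarith) (by norm_num)
      (by simp; linarith) hc, gammaIntegral_half_eq_gammaValue (a := a + 1) hg (n + 1) c hone
      (by simp; linarith), gammaValue_add_one hne fun j _ => hne' j] at key
    exact mul_left_cancel₀ (mul_ne_zero (pow_ne_zero _ (Complex.exp_ne_zero _))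
      (prod_ne_zero_iff.2 fun j _ => hne' j)) key

theorem gammaIntegral_eq_gammaValue {g : ℝ} (hg : 0 < g) (l : ℕ) {a c : ℂ} {σ : ℝ} (h0 : 0 < σ)
    (h1 : σ < a.re) (hc : |c.im| < π) : gammaIntegral g l a c σ = gammaValue g l a c := by
  set U : Set ℂ := {c | -π < c.im ∧ c.im < π} with hU
  have hUo : IsOpen U := (isOpen_lt continuous_const continuous_im).inter
    (isOpen_lt continuous_im continuous_const)
  have hUc : IsPreconnected U :=
    ((convex_halfSpace_im_gt (-π)).inter (convex_halfSpace_im_lt π)).isPreconnected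
  have e1 : AnalyticOnNhd ℂ (fun c => gammaIntegral g l a c σ) U :=
    DifferentiableOn.analyticOnNhd (fun z hz =>
      (differentiableAt_kernelIntegral_gammaWeight (A := fun _ => a) (C := fun c => c)
        (Z := fun _ => (σ : ℂ)) hg l (by fun_prop) (by fun_prop) (by fun_prop)
        (by simpa using h0) (by simpa using h1) (abs_lt.2 hz)).differentiableWithinAt) hUo
  have e2 : AnalyticOnNhd ℂ (gammaValue g l a) U :=
    DifferentiableOn.analyticOnNhd (fun z hz => by
      have hs := one_add_exp_mem_slitPlane (abs_lt.2 hz)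
      have d1 : DifferentiableAt ℂ
          (fun c => (1 + Complex.exp c) ^ (-(l * (a + g * (l - 1))))) z :=
        DifferentiableAt.cpow (by fun_prop) (by fun_prop) hs
      have d2 : DifferentiableAt ℂ
          (fun c => (2 * π : ℂ) ^ l * Complex.exp (c * (g * (l - 1) / 2 + a) * l)) z := by
        fun_prop
      exact ((d2.mul d1).mul_const _).differentiableWithinAt) hUo
  refine e1.eqOn_of_preconnected_of_frequently_eq e2 hUc (z₀ := 0) (by simp [hU, pi_pos]) ?_
    (abs_lt.1 hc)
  have ht : Filter.Tendsto (fun x : ℝ => (x : ℂ)) (nhdsWithin 0 {0}ᶜ) (nhdsWithin 0 {0}ᶜ) := by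
    refine tendsto_nhdsWithin_iff.2 ⟨?_, ?_⟩
    · exact (continuous_ofReal.tendsto' 0 0 (by simp)).mono_left nhdsWithin_le_nhds
    · filter_upwards [self_mem_nhdsWithin] with x hx
      simpa using hx
  exact ht.frequently (Filter.Eventually.of_forall fun x =>
    gammaIntegral_ofReal_eq_gammaValue hg l x h0 h1).frequently

theorem qSelbergF_eq {κ : ℝ} {l : ℕ} (m μ : ℂ) (σ : ℝ) (y : Fin l → ℝ) :
    qSelbergF κ m μ (fun u => (σ : ℂ) + Complex.I * (y u)) =
      (∏ u, gammaWeight (-m / κ) (μ - π * I) (σ + I * y u)) *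
        gammaKernel κ⁻¹ (fun u => I * y u) := by
  rw [qSelbergF, mul_sum, Complex.exp_sum, ← prod_mul_distrib]
  congr 1
  · refine prod_congr rfl fun u _ => ?_
    rw [gammaWeight, mul_assoc]
    congr 3
    ring
  · refine prod_congr rfl fun u _ => prod_congr rfl fun v _ => ?_
    simp only [gammaRatio, add_sub_add_left_eq_sub, one_div, ofReal_inv]

/-- Evaluation of the Selberg-type integral `A_l(μ;m)`: the integrand has no poles on the
contour, is absolutely integrable, and
`A_l(μ;m) = (2πi)^l e^{(μ−πi)(l−1−2m)l/(2κ)} (1−e^μ)^{l(m−l+1)/κ}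
  ∏_{j=0}^{l−1} [Γ(1+(j+1)/κ)/Γ(1+1/κ)] Γ((j−m)/κ)`,
independently of the choice of `σ` with `0 < σ < −Re(m)/κ`. -/
theorem qSelberg_integral_eval
    (κ : ℝ) (hκ : 0 < κ) (l : ℕ) (hl : 0 < l) (m μ : ℂ)
    (hm : m.re < 0) (hμim0 : 0 < μ.im) (hμim : μ.im < 2 * π)
    (σ : ℝ) (hσ0 : 0 < σ) (hσ : σ < -m.re / κ) :
    (∀ y : Fin l → ℝ, ∀ u : Fin l,
      Complex.Gamma ((σ : ℂ) + Complex.I * (y u)) ≠ 0 ∧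
      Complex.Gamma (-((σ : ℂ) + Complex.I * (y u)) - m / (κ : ℂ)) ≠ 0 ∧
      ∀ v : Fin l, v ≠ u →
        Complex.Gamma (((σ : ℂ) + Complex.I * (y u)) - ((σ : ℂ) + Complex.I * (y v))
          + 1 / (κ : ℂ)) ≠ 0) ∧
    Integrable (fun y : Fin l → ℝ =>
      qSelbergF κ m μ (fun u => (σ : ℂ) + Complex.I * (y u))) ∧
    ASelberg κ l m μ σ =
      (2 * (π : ℂ) * Complex.I) ^ l *
        Complex.exp ((μ - (π : ℂ) * Complex.I) * ((l : ℂ) - 1 - 2 * m) * (l : ℂ)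
          / (2 * (κ : ℂ))) *
        (1 - Complex.exp μ) ^ ((l : ℂ) * (m - (l : ℂ) + 1) / (κ : ℂ)) *
        ∏ j ∈ Finset.range l,
          (Complex.Gamma (1 + ((j : ℂ) + 1) / (κ : ℂ)) / Complex.Gamma (1 + 1 / (κ : ℂ))) *
            Complex.Gamma (((j : ℂ) - m) / (κ : ℂ)) := by
  have hg : 0 < κ⁻¹ := inv_pos.2 hκ
  have hare : (-m / κ : ℂ).re = -m.re / κ := by rw [div_ofReal_re, neg_re]
  have h1 : σ < (-m / κ : ℂ).re := by rwa [hare]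
  have hc : |(μ - π * I).im| < π := by
    rw [abs_lt]
    simp
    constructor <;> linarith
  have hκ0 : (κ : ℂ) ≠ 0 := by exact_mod_cast hκ.ne'
  refine ⟨fun y u => ⟨?_, ?_, fun v _ => ?_⟩, ?_, ?_⟩
  · exact Complex.Gamma_ne_zero_of_re_pos (by simpa using hσ0)
  · refine Complex.Gamma_ne_zero_of_re_pos ?_
    rw [sub_re, div_ofReal_re]
    simp
    rw [neg_div] at hσ
    linarith
  · refine Complex.Gamma_ne_zero_of_re_pos ?_
    rw [add_re, one_div, ← ofReal_inv, ofReal_re]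
    simpa using hκ
  · simp_rw [qSelbergF_eq]
    exact integrable_gammaIntegral hg l hσ0 h1 hc
  · have key := gammaIntegral_eq_gammaValue hg l hσ0 h1 hc
    rw [gammaIntegral, kernelIntegral] at key
    rw [ASelberg]
    simp_rw [qSelbergF_eq]
    rw [key, gammaValue, mul_pow _ I, mul_comm _ (I ^ l), mul_assoc (I ^ l), mul_assoc (I ^ l),
      mul_assoc (I ^ l)]
    have e : 1 + Complex.exp (μ - π * I) = 1 - Complex.exp μ := by
      rw [Complex.exp_sub, Complex.exp_pi_mul_I]
      ring
    rw [e]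
    congr 5
    · push_cast
      field_simp
      ring
    · push_cast
      field_simp
      ring
    · ext j
      congr 1
      · push_cast
        field_simp
      · push_cast
        field_simp
        ring_nf
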